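/- arXiv:1310.0239 — 3 statements merged into one kernel-verified Lean document; each statement's English description precedes it below -/
import Mathlib

section
/- Let d ≥ 3 be an odd integer and p ∈ ℝ, and let f : ℝ^{d-1} × ℝ → ℝ be smooth with compact support contained in ℝ^{d-1} × (0,∞). Then the reconstruction is local: for every x ∈ ℝ^{d-1} and y > 0, f(x, y) = (−1)^{(d−1)/2} · (y^p / (2π)^{d-1}) · ∫_0^{π/2} cos(θ)^{-(1+p)} ∫_{S^{d-2}} (Δ_u^{(d−1)/2} R^(p) f)(x + y·tan(θ)·n, θ) dn dθ, where Δ_u^{(d−1)/2} denotes the (d−1)/2-fold iterated Laplacian of R^(p) f in its first argument. -/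
open MeasureTheory Real Metric
open scoped RealInnerProductSpace

noncomputable section

/-- The standard surface measure on the unit sphere `S^{d-2} ⊆ ℝ^{d-1}`
(for `d = 2` this is the counting measure on `S^0 = {±1}`). -/
def sphereMeasure (d : ℕ) : Measure (sphere (0 : EuclideanSpace ℝ (Fin (d - 1))) 1) :=
  (volume : Measure (EuclideanSpace ℝ (Fin (d - 1)))).toSphere

/-- The conical Radon transform with radial weight `1/s^p`:
`(R^(p) f)(u, θ) = ∫_0^∞ s^(-p) ∫_{S^{d-2}} f(u + s sin θ n, s cos θ) (s sin θ)^(d-2) dn ds`. -/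
def coneRadon (d : ℕ) (p : ℝ) (f : EuclideanSpace ℝ (Fin (d - 1)) × ℝ → ℝ)
    (u : EuclideanSpace ℝ (Fin (d - 1))) (θ : ℝ) : ℝ :=
  ∫ s in Set.Ioi (0 : ℝ),
    s ^ (-p) *
      ∫ n, f (u + (s * Real.sin θ) • (n : EuclideanSpace ℝ (Fin (d - 1))), s * Real.cos θ) *
          (s * Real.sin θ) ^ (d - 2) ∂(sphereMeasure d)

/-- Fourier transform in the first argument:
`(F g)(k, θ) = ∫_{ℝ^{d-1}} e^{-i⟨k,u⟩} g(u, θ) du`. -/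
def fourierFirst (d : ℕ) (g : EuclideanSpace ℝ (Fin (d - 1)) → ℝ → ℝ)
    (k : EuclideanSpace ℝ (Fin (d - 1))) (θ : ℝ) : ℂ :=
  ∫ u, Complex.exp (-Complex.I * (⟪k, u⟫ : ℝ)) * (g u θ : ℂ)

/-- The Riesz-filtered data
`g(u, θ) = (2π)^(1-d) ∫_{ℝ^{d-1}} |k|^(d-1) (F R^(p) f)(k, θ) e^{i⟨k,u⟩} dk`. -/
def filteredData (d : ℕ) (p : ℝ) (f : EuclideanSpace ℝ (Fin (d - 1)) × ℝ → ℝ)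
    (u : EuclideanSpace ℝ (Fin (d - 1))) (θ : ℝ) : ℂ :=
  (((2 * π) ^ ((1 : ℤ) - (d : ℤ)) : ℝ) : ℂ) *
    ∫ k, ((‖k‖ ^ (d - 1) : ℝ) : ℂ) * fourierFirst d (coneRadon d p f) k θ *
      Complex.exp (Complex.I * (⟪k, u⟫ : ℝ))

/-- The Laplacian in `ℝ^{d-1}`, as the sum of the second partial derivatives. -/
def lap (d : ℕ) (h : EuclideanSpace ℝ (Fin (d - 1)) → ℝ)
    (u : EuclideanSpace ℝ (Fin (d - 1))) : ℝ :=
  ∑ i : Fin (d - 1),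
    fderiv ℝ (fun v => fderiv ℝ h v (EuclideanSpace.single i (1 : ℝ))) u
      (EuclideanSpace.single i (1 : ℝ))


namespace ConeRadon
open Set Filter Topology Module
open scoped ContDiff

section Calculus

variable {E : Type*} [NormedAddCommGroup E] [NormedSpace ℝ E] {ι : Type*} [Fintype ι]

/-- The Laplacian associated with a family of directions. -/
def laplacian (b : ι → E) (g : E → ℝ) (u : E) : ℝ :=
  ∑ i, fderiv ℝ (fun v => fderiv ℝ g v (b i)) u (b i)

/-- The derivative in the direction `v` of the first factor. -/
def derivFst (v : E) (h : E × ℝ → ℝ) (q : E × ℝ) : ℝ :=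
  fderiv ℝ h q (v, 0)

/-- The Laplacian in the first factor. -/
def laplacianFst (b : ι → E) (h : E × ℝ → ℝ) (q : E × ℝ) : ℝ :=
  ∑ i, derivFst (b i) (derivFst (b i) h) q

lemma contDiff_derivFst {h : E × ℝ → ℝ} (hh : ContDiff ℝ ∞ h) (v : E) :
    ContDiff ℝ ∞ (derivFst v h) :=
  (hh.fderiv_right (m := ∞) (by simp)).clm_apply contDiff_const

lemma hasCompactSupport_derivFst {h : E × ℝ → ℝ} (hh : HasCompactSupport h) (v : E) :
    HasCompactSupport (derivFst v h) :=
  hh.fderiv_apply (𝕜 := ℝ) _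

lemma contDiff_laplacianFst {h : E × ℝ → ℝ} (hh : ContDiff ℝ ∞ h) (b : ι → E) :
    ContDiff ℝ ∞ (laplacianFst b h) :=
  ContDiff.sum fun _ _ => contDiff_derivFst (contDiff_derivFst hh _) _

omit [Fintype ι] in
lemma hasCompactSupport_finset_sum {α : Type*} [TopologicalSpace α] {F : ι → α → ℝ}
    (hF : ∀ i, HasCompactSupport (F i)) (s : Finset ι) :
    HasCompactSupport fun a => ∑ i ∈ s, F i a := by
  classical
  induction s using Finset.induction_on with
  | empty => exact HasCompactSupport.zero
  | insert i s hi ih => simp only [Finset.sum_insert hi]; exact (hF i).add ih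

lemma hasCompactSupport_laplacianFst {h : E × ℝ → ℝ} (hh : HasCompactSupport h) (b : ι → E) :
    HasCompactSupport (laplacianFst b h) :=
  hasCompactSupport_finset_sum
    (fun _ => hasCompactSupport_derivFst (hasCompactSupport_derivFst hh _) _) _

lemma contDiff_laplacianFst_iterate {h : E × ℝ → ℝ} (hh : ContDiff ℝ ∞ h) (b : ι → E) (k : ℕ) :
    ContDiff ℝ ∞ ((laplacianFst b)^[k] h) := by
  induction k generalizing h with
  | zero => exact hh
  | succ k ih => exact ih (contDiff_laplacianFst hh b)

lemma hasCompactSupport_laplacianFst_iterate {h : E × ℝ → ℝ} (hh : HasCompactSupport h)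
    (b : ι → E) (k : ℕ) : HasCompactSupport ((laplacianFst b)^[k] h) := by
  induction k generalizing h with
  | zero => exact hh
  | succ k ih => exact ih (hasCompactSupport_laplacianFst hh b)

lemma contDiff_laplacian {g : E → ℝ} (hg : ContDiff ℝ ∞ g) (b : ι → E) :
    ContDiff ℝ ∞ (laplacian b g) :=
  ContDiff.sum fun _ _ => (((hg.fderiv_right (m := ∞) (by simp)).clm_apply
    contDiff_const).fderiv_right (m := ∞) (by simp)).clm_apply contDiff_const

lemma hasCompactSupport_laplacian {g : E → ℝ} (hg : HasCompactSupport g) (b : ι → E) :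
    HasCompactSupport (laplacian b g) :=
  hasCompactSupport_finset_sum
    (fun i => (hg.fderiv_apply (𝕜 := ℝ) (b i)).fderiv_apply (𝕜 := ℝ) (b i)) _

lemma fderiv_slice {h : E × ℝ → ℝ} (hh : ContDiff ℝ ∞ h) (x u v : E) (z : ℝ) :
    fderiv ℝ (fun u => h (x + u, z)) u v = derivFst v h (x + u, z) := by
  have h1 : HasFDerivAt (fun u : E => (x + u, z)) (ContinuousLinearMap.inl ℝ E ℝ) u :=
    ((hasFDerivAt_id u).const_add x).prodMk (hasFDerivAt_const z u)
  have h2 := ((hh.differentiable (by simp)) (x + u, z)).hasFDerivAt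
  have h3 := h2.comp u h1
  exact DFunLike.congr_fun h3.fderiv v

lemma laplacian_slice {h : E × ℝ → ℝ} (hh : ContDiff ℝ ∞ h) (b : ι → E) (x : E) (z : ℝ) :
    laplacian b (fun u => h (x + u, z)) = fun u => laplacianFst b h (x + u, z) := by
  ext u
  simp only [laplacian, laplacianFst]
  refine Finset.sum_congr rfl fun i _ => ?_
  simp only [fderiv_slice hh, fderiv_slice (contDiff_derivFst hh (b i))]

lemma laplacian_iterate_slice {h : E × ℝ → ℝ} (hh : ContDiff ℝ ∞ h) (b : ι → E) (k : ℕ) (x : E)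
    (z : ℝ) :
    (laplacian b)^[k] (fun u => h (x + u, z)) = fun u => (laplacianFst b)^[k] h (x + u, z) := by
  induction k generalizing h with
  | zero => rfl
  | succ k ih =>
    rw [Function.iterate_succ_apply, laplacian_slice hh, ih (contDiff_laplacianFst hh b)]
    rfl

lemma contDiff_slice {h : E × ℝ → ℝ} (hh : ContDiff ℝ ∞ h) (x : E) (z : ℝ) :
    ContDiff ℝ ∞ fun u => h (x + u, z) :=
  hh.comp ((contDiff_const.add contDiff_id).prodMk contDiff_const)

omit [NormedSpace ℝ E] in
/-- A compactly supported function vanishes outside a large product of balls. -/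
lemma exists_bound_support {h : E × ℝ → ℝ} (hh : HasCompactSupport h) :
    ∃ B > 0, ∀ q : E × ℝ, h q ≠ 0 → ‖q.1‖ ≤ B ∧ ‖q.2‖ ≤ B := by
  obtain ⟨B, hB, hsub⟩ := hh.isCompact.isBounded.exists_pos_norm_le
  refine ⟨B, hB, fun q hq => ?_⟩
  have := hsub q (subset_tsupport _ hq)
  rw [Prod.norm_def] at this
  exact max_le_iff.1 this

lemma exists_bound {α : Type*} [TopologicalSpace α] {h : α → ℝ} (hh : Continuous h)
    (hc : HasCompactSupport h) :
    ∃ C > 0, ∀ q, |h q| ≤ C := by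
  obtain ⟨C, hC⟩ := hh.bounded_above_of_compact_support hc
  exact ⟨max C 1, by positivity, fun q => (hC q).trans (le_max_left _ _)⟩

variable [FiniteDimensional ℝ E] [MeasurableSpace E] [BorelSpace E] {μ : Measure E}
  [μ.IsAddHaarMeasure]

omit [MeasurableSpace E] [BorelSpace E] in
lemma hasCompactSupport_slice {h : E × ℝ → ℝ} (hh : HasCompactSupport h) (x : E) (z : ℝ) :
    HasCompactSupport fun u => h (x + u, z) := by
  obtain ⟨B, hB, hs⟩ := exists_bound_support hh
  refine HasCompactSupport.of_support_subset_isCompact (isCompact_closedBall (-x) B) fun w hw => ?_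
  simpa [dist_eq_norm, add_comm] using (hs _ hw).1

lemma integrable_cone {h : E × ℝ → ℝ} (hh : Continuous h) (hc : HasCompactSupport h) (u : E)
    (σ : ℝ) : Integrable (fun w => h (u + w, ‖w‖ * σ)) μ := by
  refine Continuous.integrable_of_hasCompactSupport (by fun_prop) ?_
  obtain ⟨B, hB, hs⟩ := exists_bound_support hc
  refine HasCompactSupport.of_support_subset_isCompact (isCompact_closedBall (-u) B) fun w hw => ?_
  have := (hs _ hw).1
  simpa [dist_eq_norm, add_comm] using this

lemma hasFDerivAt_integral_cone {h : E × ℝ → ℝ} (hh : ContDiff ℝ ∞ h) (hc : HasCompactSupport h)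
    (σ : ℝ) (u : E) :
    HasFDerivAt (fun u => ∫ w, h (u + w, ‖w‖ * σ) ∂μ)
      (∫ w, (fderiv ℝ h (u + w, ‖w‖ * σ)).comp (ContinuousLinearMap.inl ℝ E ℝ) ∂μ) u := by
  obtain ⟨B, hB, hs⟩ := exists_bound_support hc
  have hcont : Continuous (fderiv ℝ h) := hh.continuous_fderiv (by simp)
  obtain ⟨C, hC⟩ := hcont.bounded_above_of_compact_support (hc.fderiv (𝕜 := ℝ))
  obtain ⟨B', hB', hs'⟩ := (hc.fderiv (𝕜 := ℝ)).isCompact.isBounded.exists_pos_norm_le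
  refine hasFDerivAt_integral_of_dominated_of_fderiv_le (s := ball u 1)
    (F := fun u w => h (u + w, ‖w‖ * σ))
    (F' := fun u w => (fderiv ℝ h (u + w, ‖w‖ * σ)).comp (ContinuousLinearMap.inl ℝ E ℝ))
    (bound := (closedBall (0 : E) (B' + ‖u‖ + 1)).indicator fun _ =>
      C * ‖ContinuousLinearMap.inl ℝ E ℝ‖) (ball_mem_nhds u one_pos) ?_
    (integrable_cone hh.continuous hc u σ) ?_ ?_ ?_ ?_
  · exact .of_forall fun v => (integrable_cone hh.continuous hc v σ).aestronglyMeasurable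
  · refine Continuous.aestronglyMeasurable ?_
    have : Continuous fun w : E => fderiv ℝ h (u + w, ‖w‖ * σ) := hcont.comp (by fun_prop)
    exact this.clm_comp continuous_const
  · refine .of_forall fun w v hv => ?_
    by_cases hw : w ∈ closedBall (0 : E) (B' + ‖u‖ + 1)
    · rw [indicator_of_mem hw]
      exact (ContinuousLinearMap.opNorm_comp_le _ _).trans (by gcongr; exact hC _)
    · rw [indicator_of_notMem hw]
      have : fderiv ℝ h (v + w, ‖w‖ * σ) = 0 := by
        by_contra hne
        have h1 := hs' _ (subset_tsupport _ hne)
        rw [Prod.norm_def] at h1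
        have h2 : ‖v + w‖ ≤ B' := (max_le_iff.1 h1).1
        have h3 : ‖w‖ ≤ ‖v + w‖ + ‖v‖ := by
          simpa using norm_sub_le (v + w) v
        have h4 : ‖v‖ ≤ ‖u‖ + ‖v - u‖ := norm_le_norm_add_norm_sub' _ _
        have h5 : ‖v - u‖ < 1 := by simpa [dist_eq_norm] using hv
        exact hw (by simp; linarith)
      simp [this]
  · exact (integrable_indicator_iff isClosed_closedBall.measurableSet).2
      (integrableOn_const (isCompact_closedBall _ _).measure_lt_top.ne)
  · refine .of_forall fun w v _ => ?_
    have h1 : HasFDerivAt (fun u : E => (u + w, ‖w‖ * σ)) (ContinuousLinearMap.inl ℝ E ℝ) v :=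
      ((hasFDerivAt_id v).add_const w).prodMk (hasFDerivAt_const _ v)
    exact ((hh.differentiable (by simp)) (v + w, ‖w‖ * σ)).hasFDerivAt.comp v h1

lemma fderiv_integral_cone {h : E × ℝ → ℝ} (hh : ContDiff ℝ ∞ h) (hc : HasCompactSupport h)
    (c σ : ℝ) (u v : E) :
    fderiv ℝ (fun u => c * ∫ w, h (u + w, ‖w‖ * σ) ∂μ) u v =
      c * ∫ w, derivFst v h (u + w, ‖w‖ * σ) ∂μ := by
  have hcont : Continuous (fderiv ℝ h) := hh.continuous_fderiv (by simp)
  rw [((hasFDerivAt_integral_cone hh hc σ u).const_mul c).fderiv]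
  rw [smul_apply, ContinuousLinearMap.integral_apply, smul_eq_mul]
  · rfl
  · refine Continuous.integrable_of_hasCompactSupport ?_ ?_
    · have : Continuous fun w : E => fderiv ℝ h (u + w, ‖w‖ * σ) := hcont.comp (by fun_prop)
      exact this.clm_comp continuous_const
    · obtain ⟨B', hB', hs'⟩ := (hc.fderiv (𝕜 := ℝ)).isCompact.isBounded.exists_pos_norm_le
      refine HasCompactSupport.of_support_subset_isCompact (isCompact_closedBall (-u) B')
        fun w hw => ?_
      have hne : fderiv ℝ h (u + w, ‖w‖ * σ) ≠ 0 := fun h0 => hw (by simp [h0])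
      have h1 := hs' _ (subset_tsupport _ hne)
      rw [Prod.norm_def] at h1
      simpa [dist_eq_norm, add_comm] using (max_le_iff.1 h1).1

lemma laplacian_integral_cone {h : E × ℝ → ℝ} (hh : ContDiff ℝ ∞ h) (hc : HasCompactSupport h)
    (b : ι → E) (c σ : ℝ) :
    laplacian b (fun u => c * ∫ w, h (u + w, ‖w‖ * σ) ∂μ) =
      fun u => c * ∫ w, laplacianFst b h (u + w, ‖w‖ * σ) ∂μ := by
  ext u
  simp only [laplacian, laplacianFst]
  rw [integral_finsetSum, Finset.mul_sum]
  · refine Finset.sum_congr rfl fun i _ => ?_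
    simp only [fderiv_integral_cone hh hc]
    rw [fderiv_integral_cone (contDiff_derivFst hh _) (hasCompactSupport_derivFst hc _)]
  · intro i _
    exact integrable_cone (contDiff_derivFst (contDiff_derivFst hh _) _).continuous
      (hasCompactSupport_derivFst (hasCompactSupport_derivFst hc _) _) u σ

lemma laplacian_iterate_integral_cone {h : E × ℝ → ℝ} (hh : ContDiff ℝ ∞ h)
    (hc : HasCompactSupport h) (b : ι → E) (c σ : ℝ) (k : ℕ) :
    (laplacian b)^[k] (fun u => c * ∫ w, h (u + w, ‖w‖ * σ) ∂μ) =
      fun u => c * ∫ w, (laplacianFst b)^[k] h (u + w, ‖w‖ * σ) ∂μ := by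
  induction k generalizing h with
  | zero => rfl
  | succ k ih =>
    rw [Function.iterate_succ_apply, laplacian_integral_cone hh hc,
      ih (contDiff_laplacianFst hh b) (hasCompactSupport_laplacianFst hc b)]
    rfl

/-- Green's formula against a smooth function. -/
lemma integral_laplacian_mul {g ψ : E → ℝ} (hg : ContDiff ℝ ∞ g) (hc : HasCompactSupport g)
    (hψ : ContDiff ℝ ∞ ψ) (b : ι → E) :
    ∫ w, laplacian b g w * ψ w ∂μ = ∫ w, g w * laplacian b ψ w ∂μ := by
  have hd {φ : E → ℝ} (hφ : ContDiff ℝ ∞ φ) (v : E) : ContDiff ℝ ∞ fun w => fderiv ℝ φ w v :=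
    (hφ.fderiv_right (m := ∞) (by simp)).clm_apply contDiff_const
  have hdiff {φ : E → ℝ} (hφ : ContDiff ℝ ∞ φ) : Differentiable ℝ φ :=
    hφ.differentiable (by simp)
  have key {a c : E → ℝ} (ha : ContDiff ℝ ∞ a) (hac : HasCompactSupport a)
      (hcc : ContDiff ℝ ∞ c) (v : E) :
      ∫ w, fderiv ℝ a w v * c w ∂μ = - ∫ w, a w * fderiv ℝ c w v ∂μ := by
    rw [integral_mul_fderiv_eq_neg_fderiv_mul_of_integrable, neg_neg]
    · exact ((hd ha v).continuous.mul hcc.continuous).integrable_of_hasCompactSupport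
        (hac.fderiv_apply (𝕜 := ℝ) v).mul_right
    · exact (ha.continuous.mul (hd hcc v).continuous).integrable_of_hasCompactSupport hac.mul_right
    · exact (ha.continuous.mul hcc.continuous).integrable_of_hasCompactSupport hac.mul_right
    · exact fun x _ => hdiff ha x
    · exact fun x _ => hdiff hcc x
  simp only [laplacian, Finset.sum_mul, Finset.mul_sum]
  rw [integral_finsetSum, integral_finsetSum]
  · refine Finset.sum_congr rfl fun i _ => ?_
    rw [key (hd hg (b i)) (hc.fderiv_apply (𝕜 := ℝ) (b i)) hψ,
      key hg hc (hd hψ (b i)), neg_neg]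
  · exact fun i _ => (hg.continuous.mul (hd (hd hψ _) _).continuous).integrable_of_hasCompactSupport
      hc.mul_right
  · exact fun i _ =>
      ((hd (hd hg _) _).continuous.mul hψ.continuous).integrable_of_hasCompactSupport
      ((hc.fderiv_apply (𝕜 := ℝ) (b i)).fderiv_apply (𝕜 := ℝ) (b i)).mul_right

lemma integral_laplacian {g : E → ℝ} (hg : ContDiff ℝ ∞ g) (hc : HasCompactSupport g)
    (b : ι → E) : ∫ w, laplacian b g w ∂μ = 0 := by
  have := integral_laplacian_mul (μ := μ) hg hc (contDiff_const (c := (1 : ℝ))) b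
  simpa [laplacian] using this

end Calculus

section Sphere

variable {E : Type*} [NormedAddCommGroup E] [NormedSpace ℝ E] [FiniteDimensional ℝ E]
  [MeasurableSpace E] [BorelSpace E] [Nontrivial E] (μ : Measure E) [μ.IsAddHaarMeasure]

/-- Integration in polar coordinates. -/
lemma integral_polar {Ψ : E → ℝ} (hΨ : Integrable Ψ μ) :
    ∫ r in Ioi (0 : ℝ), r ^ (finrank ℝ E - 1) * ∫ n, Ψ (r • (n : E)) ∂μ.toSphere =
      ∫ w, Ψ w ∂μ := by
  have hmp := μ.measurePreserving_homeomorphUnitSphereProd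
  have hemb := (homeomorphUnitSphereProd E).measurableEmbedding
  set G : sphere (0 : E) 1 × Ioi (0 : ℝ) → ℝ := fun q => Ψ ((q.2 : ℝ) • (q.1 : E)) with hG
  have hcomp : ∀ w : ({0}ᶜ : Set E), G (homeomorphUnitSphereProd E w) = Ψ w := by
    intro w
    have hw : ‖(w : E)‖ ≠ 0 := norm_ne_zero_iff.2 w.2
    simp [hG, smul_smul, hw]
  have hint : Integrable G (μ.toSphere.prod (Measure.volumeIoiPow (finrank ℝ E - 1))) := by
    rw [← hmp.integrable_comp_emb hemb]
    have : G ∘ homeomorphUnitSphereProd E = Ψ ∘ Subtype.val := funext hcomp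
    rw [this]
    refine (integrableOn_iff_comap_subtypeVal (measurableSet_singleton _).compl).1 ?_
    exact hΨ.integrableOn
  calc ∫ r in Ioi (0 : ℝ), r ^ (finrank ℝ E - 1) * ∫ n, Ψ (r • (n : E)) ∂μ.toSphere
    _ = ∫ r : Ioi (0 : ℝ), ∫ n, G (n, r) ∂μ.toSphere ∂Measure.volumeIoiPow (finrank ℝ E - 1) := by
      simp only [Measure.volumeIoiPow, ENNReal.ofReal]
      rw [integral_withDensity_eq_integral_smul,
        integral_subtype_comap measurableSet_Ioi fun a : ℝ =>
          Real.toNNReal (a ^ (finrank ℝ E - 1)) • ∫ n, Ψ (a • (n : E)) ∂μ.toSphere]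
      · refine setIntegral_congr_fun measurableSet_Ioi fun r hr => ?_
        rw [NNReal.smul_def, Real.coe_toNNReal _ (pow_nonneg (le_of_lt hr) _), smul_eq_mul]
      · exact (measurable_subtype_coe.pow_const _).real_toNNReal
    _ = ∫ q, G q ∂μ.toSphere.prod (Measure.volumeIoiPow (finrank ℝ E - 1)) :=
      (integral_prod_symm _ hint).symm
    _ = ∫ w : ({0}ᶜ : Set E), Ψ w ∂(μ.comap (↑)) := by
      rw [← hmp.integral_comp hemb]
      exact integral_congr_ae (.of_forall hcomp)
    _ = ∫ w, Ψ w ∂μ := by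
      rw [integral_subtype_comap (measurableSet_singleton _).compl, restrict_compl_singleton]

end Sphere

section Rotation

variable {E : Type*} [NormedAddCommGroup E] [InnerProductSpace ℝ E] [FiniteDimensional ℝ E]
  [MeasurableSpace E] [BorelSpace E]

/-- The restriction of a linear isometry to the unit sphere. -/
def sphereMap (T : E ≃ₗᵢ[ℝ] E) : sphere (0 : E) 1 ≃ₜ sphere (0 : E) 1 where
  toFun n := ⟨T n, by simp⟩
  invFun n := ⟨T.symm n, by simp⟩
  left_inv n := by simp
  right_inv n := by simp
  continuous_toFun := by fun_prop
  continuous_invFun := by fun_prop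

lemma measurePreserving_sphereMap (T : E ≃ₗᵢ[ℝ] E) :
    MeasurePreserving (sphereMap T) (volume : Measure E).toSphere
      (volume : Measure E).toSphere := by
  refine ⟨(sphereMap T).measurable, ?_⟩
  ext s hs
  rw [Measure.map_apply (sphereMap T).measurable hs, Measure.toSphere_apply' _ hs,
    Measure.toSphere_apply' _ ((sphereMap T).measurable hs)]
  congr 1
  conv_rhs => rw [← T.measurePreserving.measure_preimage_emb T.toHomeomorph.measurableEmbedding]
  congr 1
  ext w
  rw [mem_preimage, Set.mem_smul, Set.mem_smul]
  constructor
  · rintro ⟨r, hr, _, ⟨n, hn, rfl⟩, rfl⟩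
    exact ⟨r, hr, _, ⟨_, hn, rfl⟩, by simp [sphereMap]⟩
  · rintro ⟨r, hr, _, ⟨n, hn, rfl⟩, h⟩
    refine ⟨r, hr, _, ⟨(sphereMap T).symm n, by simpa using hn, rfl⟩, T.injective ?_⟩
    rw [← h]
    simp [sphereMap]

lemma integral_sphere_norm_sub {e e' : E} (he : ‖e‖ = ‖e'‖) (φ : ℝ → ℝ) (a : ℝ) :
    ∫ n : sphere (0 : E) 1, φ ‖e - a • (n : E)‖ ∂(volume : Measure E).toSphere =
      ∫ n : sphere (0 : E) 1, φ ‖e' - a • (n : E)‖ ∂(volume : Measure E).toSphere := by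
  obtain ⟨T, hT⟩ : ∃ T : E ≃ₗᵢ[ℝ] E, T e = e' := ⟨_, Submodule.reflection_sub he⟩
  rw [← (measurePreserving_sphereMap T).integral_comp (sphereMap T).measurableEmbedding
    fun n => φ ‖e' - a • (n : E)‖]
  refine integral_congr_ae (.of_forall fun n => ?_)
  have : e' - a • ((sphereMap T n : sphere (0 : E) 1) : E) = T (e - a • (n : E)) := by
    simp [sphereMap, hT]
  simp only [this, LinearIsometryEquiv.norm_map]

end Rotation

section FundamentalSolution

variable {E : Type*} [NormedAddCommGroup E] [InnerProductSpace ℝ E] {ι : Type*} [Fintype ι]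

lemma hasFDerivAt_norm_sq_add (a : ℝ) (w : E) :
    HasFDerivAt (fun w : E => ‖w‖ ^ 2 + a) (2 • innerSL ℝ w) w :=
  (hasStrictFDerivAt_norm_sq w).hasFDerivAt.add_const a

/-- The Laplacian of a radial function. -/
lemma laplacian_radial (b : OrthonormalBasis ι ℝ E) {ψ ψ₁ ψ₂ : ℝ → ℝ}
    (h₁ : ∀ q, 0 < q → HasDerivAt ψ (ψ₁ q) q) (h₂ : ∀ q, 0 < q → HasDerivAt ψ₁ (ψ₂ q) q)
    {a : ℝ} (ha : 0 < a) (w : E) :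
    laplacian b (fun w => ψ (‖w‖ ^ 2 + a)) w =
      4 * ‖w‖ ^ 2 * ψ₂ (‖w‖ ^ 2 + a) + 2 * Fintype.card ι * ψ₁ (‖w‖ ^ 2 + a) := by
  have hq (w : E) : 0 < ‖w‖ ^ 2 + a := by positivity
  have hfst (v : E) (i : ι) : fderiv ℝ (fun w : E => ψ (‖w‖ ^ 2 + a)) v (b i) =
      ψ₁ (‖v‖ ^ 2 + a) * (2 * ⟪v, b i⟫) := by
    have hA : HasFDerivAt (fun w : E => ψ (‖w‖ ^ 2 + a)) _ v :=
      (h₁ _ (hq v)).comp_hasFDerivAt v (hasFDerivAt_norm_sq_add a v)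
    rw [hA.fderiv]
    simp
  have hsnd (i : ι) : fderiv ℝ (fun v : E => ψ₁ (‖v‖ ^ 2 + a) * (2 * ⟪v, b i⟫)) w (b i) =
      4 * ⟪w, b i⟫ ^ 2 * ψ₂ (‖w‖ ^ 2 + a) + 2 * ψ₁ (‖w‖ ^ 2 + a) := by
    have hA : HasFDerivAt (fun w : E => ψ₁ (‖w‖ ^ 2 + a)) _ w :=
      (h₂ _ (hq w)).comp_hasFDerivAt w (hasFDerivAt_norm_sq_add a w)
    have hB : HasFDerivAt (fun v : E => 2 * ⟪v, b i⟫) ((2 : ℝ) • innerSL ℝ (b i)) w := by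
      have := ((innerSL ℝ (b i)).hasFDerivAt (x := w)).const_mul (2 : ℝ)
      simpa [real_inner_comm] using this
    rw [(hA.fun_mul hB).fderiv]
    simp only [add_apply, smul_apply, innerSL_apply_apply, smul_eq_mul, nsmul_eq_mul,
      real_inner_self_eq_norm_sq, b.norm_eq_one]
    norm_num
    ring
  simp only [laplacian, hfst, hsnd]
  rw [Finset.sum_add_distrib, ← Finset.sum_mul, ← Finset.mul_sum, Finset.sum_const]
  have : ∑ i, ⟪w, b i⟫ ^ 2 = ‖w‖ ^ 2 := by
    simpa using b.sum_sq_norm_inner_left w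
  rw [this, Finset.card_univ, nsmul_eq_mul]
  ring

lemma laplacian_radial_pow (b : OrthonormalBasis ι ℝ E) {ψ : ℝ → ℝ} {κ : ℝ} {j : ℕ}
    (hψ : ∀ q, 0 < q → HasDerivAt ψ (κ * (q ^ (j + 1))⁻¹) q) {a : ℝ} (ha : 0 < a) (w : E) :
    laplacian b (fun w => ψ (‖w‖ ^ 2 + a)) w =
      κ * (2 * Fintype.card ι - 4 * (j + 1)) * ((‖w‖ ^ 2 + a) ^ (j + 1))⁻¹ +
        4 * κ * (j + 1) * (a * ((‖w‖ ^ 2 + a) ^ (j + 2))⁻¹) := by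
  have h₂ : ∀ q : ℝ, 0 < q → HasDerivAt (fun q => κ * (q ^ (j + 1))⁻¹)
      (-(κ * (j + 1) * (q ^ (j + 2))⁻¹)) q := by
    intro q hq
    have := ((hasDerivAt_pow (j + 1) q).fun_inv (pow_ne_zero _ hq.ne')).const_mul κ
    refine this.congr_deriv ?_
    push_cast
    field_simp
    simp
    ring
  rw [laplacian_radial b hψ h₂ ha]
  have hq : 0 < ‖w‖ ^ 2 + a := by positivity
  set q := ‖w‖ ^ 2 + a with hqd
  have : ‖w‖ ^ 2 = q - a := by simp [hqd]
  rw [this]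
  field_simp
  ring

variable [FiniteDimensional ℝ E] [MeasurableSpace E] [BorelSpace E] [Nontrivial E]

lemma locallyIntegrable_norm_pow_inv (μ : Measure E)
    [μ.IsAddHaarMeasure] {i : ℕ} (hi : i < finrank ℝ E) :
    LocallyIntegrable (fun w : E => (‖w‖ ^ i)⁻¹) μ := by
  intro x
  refine ⟨ball 0 (‖x‖ + 1), isOpen_ball.mem_nhds (by simp), ?_⟩
  rw [integrableOn_fun_norm_addHaar μ (f := fun y => (y ^ i)⁻¹)]
  have : IntegrableOn (fun y : ℝ => y ^ (finrank ℝ E - 1 - i)) (Ioo 0 (‖x‖ + 1)) :=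
    ((continuous_pow _).integrableOn_Icc (a := 0) (b := ‖x‖ + 1)).mono_set Ioo_subset_Icc_self
  refine this.congr_fun (fun y hy => ?_) measurableSet_Ioo
  have hy : y ≠ 0 := hy.1.ne'
  simp only [smul_eq_mul]
  exact pow_sub₀ y hy (by omega)

lemma locallyIntegrable_log_norm (μ : Measure E) [μ.IsAddHaarMeasure] (hd : 1 < finrank ℝ E) :
    LocallyIntegrable (fun w : E => log ‖w‖) μ := by
  refine ((locallyIntegrable_norm_pow_inv μ hd).add
    (continuous_norm.locallyIntegrable (μ := μ))).mono ?_ (.of_forall fun w => ?_)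
  · exact (measurable_log.comp measurable_norm).aestronglyMeasurable
  · rw [norm_eq_abs, norm_eq_abs]
    rcases eq_or_ne w 0 with rfl | hw
    · simp
    have hw : 0 < ‖w‖ := norm_pos_iff.2 hw
    have h1 := log_le_self hw.le
    have h2 := log_le_self (inv_pos.2 hw).le
    rw [log_inv] at h2
    have h3 : 0 < ‖w‖⁻¹ := inv_pos.2 hw
    simp only [Pi.add_apply, pow_one]
    rw [abs_of_pos (by positivity : 0 < ‖w‖⁻¹ + ‖w‖), abs_le]
    constructor <;> linarith

/-- Regularizing the argument `‖w‖ ^ 2` of a radial kernel does not matter in the limit. -/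
lemma tendsto_integral_regularized {ψ : ℝ → ℝ} (hψ : ContinuousOn ψ (Ioi 0))
    (hmono : MonotoneOn ψ (Ioi 0) ∨ AntitoneOn ψ (Ioi 0))
    (hloc : LocallyIntegrable (fun w : E => ψ (‖w‖ ^ 2)))
    {g : E → ℝ} (hg : Continuous g) (hc : HasCompactSupport g) :
    Tendsto (fun a => ∫ w, g w * ψ (‖w‖ ^ 2 + a)) (𝓝[>] 0) (𝓝 (∫ w, g w * ψ (‖w‖ ^ 2))) := by
  obtain ⟨B, hB, hs⟩ := hc.isCompact.isBounded.exists_pos_norm_le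
  have hbd : ∀ p q r, 0 < p → p ≤ q → q ≤ r → |ψ q| ≤ |ψ p| + |ψ r| := by
    intro p q r hp hpq hqr
    have h1 := neg_abs_le (ψ p)
    have h2 := neg_abs_le (ψ r)
    have h3 := le_abs_self (ψ p)
    have h4 := le_abs_self (ψ r)
    rcases hmono with h | h
    · have h5 := h (mem_Ioi.2 hp) (mem_Ioi.2 (by linarith)) hpq
      have h6 := h (mem_Ioi.2 (by linarith)) (mem_Ioi.2 (by linarith)) hqr
      exact abs_le.2 ⟨by linarith [abs_nonneg (ψ r)], by linarith [abs_nonneg (ψ p)]⟩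
    · have h5 := h (mem_Ioi.2 hp) (mem_Ioi.2 (by linarith)) hpq
      have h6 := h (mem_Ioi.2 (by linarith)) (mem_Ioi.2 (by linarith)) hqr
      exact abs_le.2 ⟨by linarith [abs_nonneg (ψ p)], by linarith [abs_nonneg (ψ r)]⟩
  have hne : ∀ᵐ w : E, w ≠ 0 := by simp [ae_iff]
  refine tendsto_integral_filter_of_dominated_convergence
    (fun w => |g w * ψ (‖w‖ ^ 2)| + |g w * ψ (B ^ 2 + 1)|) ?_ ?_ ?_ ?_
  · filter_upwards [self_mem_nhdsWithin] with a (ha : 0 < a)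
    refine (hg.mul (hψ.comp_continuous (by fun_prop) fun w => ?_)).aestronglyMeasurable
    exact mem_Ioi.2 (by positivity)
  · filter_upwards [Ioo_mem_nhdsGT (zero_lt_one (α := ℝ))] with a ha
    filter_upwards [hne] with w hw
    by_cases hgw : g w = 0
    · simp [hgw]
    have hwB : ‖w‖ ≤ B := hs w (subset_tsupport _ hgw)
    have hw : 0 < ‖w‖ := norm_pos_iff.2 hw
    rw [norm_eq_abs, abs_mul, abs_mul, abs_mul, ← mul_add]
    refine mul_le_mul_of_nonneg_left (hbd _ _ _ (by positivity) (by linarith [ha.1]) ?_)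
      (abs_nonneg _)
    have : ‖w‖ ^ 2 ≤ B ^ 2 := by gcongr
    linarith [ha.2]
  · refine Integrable.add ?_ ?_
    · exact (hloc.integrable_smul_left_of_hasCompactSupport hg hc).abs
    · exact ((hg.integrable_of_hasCompactSupport hc).mul_const _).abs
  · filter_upwards [hne] with w hw
    have hw : 0 < ‖w‖ := norm_pos_iff.2 hw
    have h1 : ContinuousAt ψ (‖w‖ ^ 2) :=
      hψ.continuousAt (Ioi_mem_nhds (by positivity))
    refine Tendsto.const_mul _ (h1.tendsto.comp ?_)
    have : Tendsto (fun a : ℝ => ‖w‖ ^ 2 + a) (𝓝 0) (𝓝 (‖w‖ ^ 2 + 0)) :=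
      tendsto_const_nhds.add tendsto_id
    rw [add_zero] at this
    exact this.mono_left nhdsWithin_le_nhds

lemma antitoneOn_pow_inv (j : ℕ) : AntitoneOn (fun q : ℝ => (q ^ j)⁻¹) (Ioi 0) := by
  intro a ha b hb hab
  have ha : 0 < a := ha
  dsimp only
  gcongr

lemma continuousOn_pow_inv (j : ℕ) : ContinuousOn (fun q : ℝ => (q ^ j)⁻¹) (Ioi 0) :=
  (continuous_pow j).continuousOn.inv₀ fun q (hq : 0 < q) => pow_ne_zero _ hq.ne'

lemma tendsto_integral_remainder {j : ℕ} (hj : 2 * (j + 1) < finrank ℝ E) {g : E → ℝ}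
    (hg : Continuous g) (hc : HasCompactSupport g) :
    Tendsto (fun a => ∫ w, g w * (a * ((‖w‖ ^ 2 + a) ^ (j + 2))⁻¹)) (𝓝[>] 0) (𝓝 0) := by
  have hne : ∀ᵐ w : E, w ≠ 0 := by simp [ae_iff]
  have hloc := locallyIntegrable_norm_pow_inv (volume : Measure E) hj
  suffices h : Tendsto (fun a => ∫ w, g w * (a * ((‖w‖ ^ 2 + a) ^ (j + 2))⁻¹)) (𝓝[>] 0)
      (𝓝 (∫ _ : E, (0 : ℝ))) by simpa using h
  refine tendsto_integral_filter_of_dominated_convergence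
    (fun w => |g w * (‖w‖ ^ (2 * (j + 1)))⁻¹|) ?_ ?_ ?_ ?_
  · filter_upwards [self_mem_nhdsWithin] with a (ha : 0 < a)
    refine (hg.mul (continuous_const.mul (Continuous.inv₀ (by fun_prop) fun w => ?_)))
      |>.aestronglyMeasurable
    positivity
  · filter_upwards [self_mem_nhdsWithin] with a (ha : 0 < a)
    filter_upwards [hne] with w hw
    have hw : 0 < ‖w‖ := norm_pos_iff.2 hw
    rw [norm_eq_abs, abs_mul (g w), abs_mul (g w)]
    refine mul_le_mul_of_nonneg_left ?_ (abs_nonneg _)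
    rw [abs_of_pos (by positivity), abs_of_pos (by positivity), pow_mul]
    calc a * ((‖w‖ ^ 2 + a) ^ (j + 2))⁻¹
      _ ≤ (‖w‖ ^ 2 + a) * ((‖w‖ ^ 2 + a) ^ (j + 2))⁻¹ := by
        gcongr
        exact le_add_of_nonneg_left (sq_nonneg ‖w‖)
      _ = ((‖w‖ ^ 2 + a) ^ (j + 1))⁻¹ := by
        field_simp
        ring
      _ ≤ ((‖w‖ ^ 2) ^ (j + 1))⁻¹ := by
        gcongr
        linarith
  · exact (hloc.integrable_smul_left_of_hasCompactSupport hg hc).abs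
  · filter_upwards [hne] with w hw
    have hw : 0 < ‖w‖ := norm_pos_iff.2 hw
    have : ContinuousAt (fun a : ℝ => g w * (a * ((‖w‖ ^ 2 + a) ^ (j + 2))⁻¹)) 0 := by
      refine continuousAt_const.mul (continuousAt_id.mul (ContinuousAt.inv₀ (by fun_prop) ?_))
      positivity
    have := this.tendsto
    simp only [zero_mul, mul_zero] at this
    exact this.mono_left nhdsWithin_le_nhds

end FundamentalSolution

section FundamentalSolution

variable {E : Type*} [NormedAddCommGroup E] [InnerProductSpace ℝ E] {ι : Type*} [Fintype ι]
variable [FiniteDimensional ℝ E] [MeasurableSpace E] [BorelSpace E]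

lemma integral_laplacian_mul_regularized (b : OrthonormalBasis ι ℝ E) {ψ : ℝ → ℝ} {κ : ℝ} {j : ℕ}
    (hψ : ∀ q, 0 < q → HasDerivAt ψ (κ * (q ^ (j + 1))⁻¹) q) (hs : ContDiffOn ℝ ∞ ψ (Ioi 0))
    {g : E → ℝ} (hg : ContDiff ℝ ∞ g) (hc : HasCompactSupport g) {a : ℝ} (ha : 0 < a) :
    ∫ w, laplacian b g w * ψ (‖w‖ ^ 2 + a) =
      κ * (2 * finrank ℝ E - 4 * (j + 1)) * (∫ w, g w * ((‖w‖ ^ 2 + a) ^ (j + 1))⁻¹) +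
        4 * κ * (j + 1) * ∫ w, g w * (a * ((‖w‖ ^ 2 + a) ^ (j + 2))⁻¹) := by
  have hsm : ContDiff ℝ ∞ fun w : E => ψ (‖w‖ ^ 2 + a) := by
    refine hs.comp_contDiff ((contDiff_norm_sq ℝ).add contDiff_const) fun w => ?_
    exact mem_Ioi.2 (by positivity)
  rw [integral_laplacian_mul hg hc hsm]
  have hcont (i : ℕ) : Continuous fun w : E => ((‖w‖ ^ 2 + a) ^ i)⁻¹ :=
    Continuous.inv₀ (by fun_prop) fun w => by positivity
  have hi (c : ℝ) (i : ℕ) : Integrable fun w => g w * (c * ((‖w‖ ^ 2 + a) ^ i)⁻¹) :=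
    (hg.continuous.mul (continuous_const.mul (hcont i))).integrable_of_hasCompactSupport hc.mul_right
  have hi' (i : ℕ) : Integrable fun w => g w * ((‖w‖ ^ 2 + a) ^ i)⁻¹ := by simpa using hi 1 i
  rw [← integral_const_mul, ← integral_const_mul, ← integral_add ((hi' _).const_mul _)
    ((hi _ _).const_mul _), finrank_eq_card_basis b.toBasis]
  refine integral_congr_ae (.of_forall fun w => ?_)
  dsimp only
  rw [laplacian_radial_pow b hψ ha]
  ring

variable [Nontrivial E]

/-- The action of the Laplacian on the power kernels below the critical exponent. -/
lemma integral_laplacian_mul_of_lt (b : OrthonormalBasis ι ℝ E) {ψ : ℝ → ℝ} {κ : ℝ} {j : ℕ}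
    (hψ : ∀ q, 0 < q → HasDerivAt ψ (κ * (q ^ (j + 1))⁻¹) q) (hs : ContDiffOn ℝ ∞ ψ (Ioi 0))
    (hmono : MonotoneOn ψ (Ioi 0) ∨ AntitoneOn ψ (Ioi 0))
    (hloc : LocallyIntegrable (fun w : E => ψ (‖w‖ ^ 2))) (hj : 2 * (j + 1) < finrank ℝ E)
    {g : E → ℝ} (hg : ContDiff ℝ ∞ g) (hc : HasCompactSupport g) :
    ∫ w, laplacian b g w * ψ (‖w‖ ^ 2) =
      κ * (2 * finrank ℝ E - 4 * (j + 1)) * ∫ w, g w * ((‖w‖ ^ 2) ^ (j + 1))⁻¹ := by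
  have h1 := tendsto_integral_regularized hs.continuousOn hmono hloc
    (contDiff_laplacian hg b).continuous (hasCompactSupport_laplacian hc b)
  have h2 := tendsto_integral_regularized (E := E) (continuousOn_pow_inv (j + 1))
    (Or.inr (antitoneOn_pow_inv (j + 1)))
    (by simpa only [← pow_mul] using locallyIntegrable_norm_pow_inv volume hj) hg.continuous hc
  have h3 := tendsto_integral_remainder hj hg.continuous hc
  have h4 := (h2.const_mul (κ * (2 * finrank ℝ E - 4 * (j + 1)))).add
    (h3.const_mul (4 * κ * (j + 1)))
  rw [mul_zero, add_zero] at h4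
  refine tendsto_nhds_unique h1 (h4.congr' ?_)
  filter_upwards [self_mem_nhdsWithin] with a ha
  exact (integral_laplacian_mul_regularized b hψ hs hg hc ha).symm

omit [Nontrivial E] in
lemma integrable_one_add_norm_sq_pow_inv {k : ℕ} (hk : finrank ℝ E = 2 * k) :
    Integrable fun w : E => ((1 + ‖w‖ ^ 2) ^ (k + 1))⁻¹ := by
  have := integrable_rpow_neg_one_add_norm_sq (E := E) (μ := volume) (r := 2 * ((k : ℝ) + 1))
    (by rw [hk]; push_cast; linarith)
  refine this.congr (.of_forall fun w => ?_)
  have hq : 0 ≤ 1 + ‖w‖ ^ 2 := by positivity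
  have : -(2 * ((k : ℝ) + 1)) / 2 = -((k + 1 : ℕ) : ℝ) := by push_cast; ring
  simp only [this]
  rw [rpow_neg hq, rpow_natCast]

lemma integral_one_add_norm_sq_pow_inv {k : ℕ} (hk : finrank ℝ E = 2 * k) :
    ∫ w : E, ((1 + ‖w‖ ^ 2) ^ (k + 1))⁻¹ =
      (volume : Measure E).toSphere.real univ / (2 * k) := by
  have hk0 : 0 < k := by have := finrank_pos (R := ℝ) (M := E); omega
  have hint := integrable_one_add_norm_sq_pow_inv hk
  rw [integrable_fun_norm_addHaar volume (f := fun r => ((1 + r ^ 2) ^ (k + 1))⁻¹)] at hint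
  rw [integral_fun_norm_addHaar volume (fun r => ((1 + r ^ 2) ^ (k + 1))⁻¹),
    Measure.toSphere_real_apply_univ]
  have hder : ∀ r ∈ Ioi (0 : ℝ), HasDerivAt (fun r : ℝ => (r ^ 2 / (1 + r ^ 2)) ^ k / (2 * k))
      (r ^ (finrank ℝ E - 1) • ((1 + r ^ 2) ^ (k + 1))⁻¹) r := by
    intro r hr
    have hr : 0 < r := hr
    have hq : 1 + r ^ 2 ≠ 0 := by positivity
    have h1 := (((hasDerivAt_pow 2 r).div ((hasDerivAt_pow 2 r).const_add 1) hq).pow k).div_const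
      (2 * (k : ℝ))
    refine h1.congr_deriv ?_
    obtain ⟨k, rfl⟩ := Nat.exists_eq_succ_of_ne_zero hk0.ne'
    rw [hk]
    have : 2 * k.succ - 1 = 2 * k + 1 := by omega
    rw [this]
    simp only [Nat.succ_eq_add_one, Nat.add_sub_cancel, smul_eq_mul, Pi.div_apply, div_pow]
    have hk' : ((k + 1 : ℕ) : ℝ) ≠ 0 := by positivity
    field_simp
    push_cast
    ring
  have hlim : Tendsto (fun r : ℝ => (r ^ 2 / (1 + r ^ 2)) ^ k / (2 * k)) atTop
      (𝓝 ((1 : ℝ) ^ k / (2 * k))) := by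
    refine (Tendsto.pow ?_ k).div_const _
    have h1 : Tendsto (fun r : ℝ => 1 - (1 + r ^ 2)⁻¹) atTop (𝓝 (1 - 0)) := by
      refine tendsto_const_nhds.sub (tendsto_inv_atTop_zero.comp ?_)
      exact tendsto_atTop_add_const_left _ _ (tendsto_pow_atTop two_ne_zero)
    rw [sub_zero] at h1
    refine h1.congr fun r => ?_
    have hq : 1 + r ^ 2 ≠ 0 := by positivity
    field_simp
    ring
  rw [integral_Ioi_of_hasDerivAt_of_tendsto ?_ hder hint hlim]
  · have : (k : ℝ) ≠ 0 := by positivity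
    rw [hk]
    simp [hk0.ne']
    field_simp
  · refine ContinuousAt.continuousWithinAt ?_
    have : (1 : ℝ) + 0 ^ 2 ≠ 0 := by norm_num
    fun_prop (disch := simpa using this)

/-- The remainder term concentrates at the origin for the critical exponent. -/
lemma tendsto_integral_remainder_critical {k : ℕ} (hk : finrank ℝ E = 2 * k) {g : E → ℝ}
    (hg : Continuous g) (hc : HasCompactSupport g) :
    Tendsto (fun a => ∫ w, g w * (a * ((‖w‖ ^ 2 + a) ^ (k + 1))⁻¹)) (𝓝[>] 0)
      (𝓝 ((volume : Measure E).toSphere.real univ / (2 * k) * g 0)) := by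
  have hk0 : 0 < k := by have := finrank_pos (R := ℝ) (M := E); omega
  set A := (volume : Measure E).toSphere.real univ / (2 * k) with hA
  have hA0 : 0 < A := by
    have h1 : 0 < (volume : Measure E).real (ball 0 1) :=
      ENNReal.toReal_pos (isOpen_ball.measure_pos _ ⟨0, by simp⟩).ne' measure_ball_lt_top.ne
    rw [hA, Measure.toSphere_real_apply_univ, hk]
    positivity
  have key := tendsto_integral_comp_smul_smul_of_integrable (μ := (volume : Measure E))
    (φ := fun w => A⁻¹ * ((1 + ‖w‖ ^ 2) ^ (k + 1))⁻¹) (fun w => by positivity)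
    (by rw [integral_const_mul, integral_one_add_norm_sq_pow_inv hk, inv_mul_cancel₀ hA0.ne'])
    ?_ (hg.integrable_of_hasCompactSupport hc) hg.continuousAt
  · have hcomp : Tendsto (fun a : ℝ => (√a)⁻¹) (𝓝[>] 0) atTop := by
      refine tendsto_inv_nhdsGT_zero.comp (tendsto_nhdsWithin_iff.2 ⟨?_, ?_⟩)
      · have := (continuous_sqrt.tendsto 0)
        rw [sqrt_zero] at this
        exact this.mono_left nhdsWithin_le_nhds
      · filter_upwards [self_mem_nhdsWithin] with a ha using sqrt_pos.2 ha
    have := (key.comp hcomp).const_mul A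
    refine this.congr' ?_
    filter_upwards [self_mem_nhdsWithin] with a (ha : 0 < a)
    simp only [Function.comp_apply]
    rw [← integral_const_mul]
    refine integral_congr_ae (.of_forall fun w => ?_)
    simp only [norm_smul, norm_inv, norm_eq_abs, hk, smul_eq_mul, pow_mul, mul_pow, inv_pow, sq_abs,
      sq_sqrt ha.le]
    have hq : 0 < ‖w‖ ^ 2 + a := by positivity
    have : 1 + a⁻¹ * ‖w‖ ^ 2 = a⁻¹ * (‖w‖ ^ 2 + a) := by field_simp; ring
    rw [this, mul_pow, inv_pow]
    field_simp
    ring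
  · refine squeeze_zero' (.of_forall fun w => by positivity)
      (g := fun w => A⁻¹ * ((‖w‖)⁻¹)) ?_ ?_
    · filter_upwards [eventually_cobounded_le_norm 1] with w hw
      have h0 : 0 < ‖w‖ := by linarith
      have : ‖w‖ ^ (2 * k + 1) ≤ (1 + ‖w‖ ^ 2) ^ (k + 1) := by
        calc ‖w‖ ^ (2 * k + 1) ≤ ‖w‖ ^ (2 * (k + 1)) := pow_le_pow_right₀ hw (by omega)
          _ = (‖w‖ ^ 2) ^ (k + 1) := pow_mul _ _ _
          _ ≤ _ := by gcongr; linarith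
      rw [hk, mul_left_comm]
      gcongr
      rw [← div_eq_mul_inv, div_le_iff₀ (by positivity), ← div_eq_inv_mul, le_div_iff₀ h0]
      simpa [pow_succ] using this
    · have := (tendsto_inv_atTop_zero.comp (tendsto_norm_cobounded_atTop (E := E))).const_mul A⁻¹
      simpa using this

/-- The action of the Laplacian on the power kernel of critical exponent. -/
lemma integral_laplacian_mul_critical (b : OrthonormalBasis ι ℝ E) {ψ : ℝ → ℝ} {κ : ℝ} {j : ℕ}
    (hψ : ∀ q, 0 < q → HasDerivAt ψ (κ * (q ^ (j + 1))⁻¹) q) (hs : ContDiffOn ℝ ∞ ψ (Ioi 0))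
    (hmono : MonotoneOn ψ (Ioi 0) ∨ AntitoneOn ψ (Ioi 0))
    (hloc : LocallyIntegrable (fun w : E => ψ (‖w‖ ^ 2))) (hj : finrank ℝ E = 2 * (j + 1))
    {g : E → ℝ} (hg : ContDiff ℝ ∞ g) (hc : HasCompactSupport g) :
    ∫ w, laplacian b g w * ψ (‖w‖ ^ 2) =
      2 * κ * (volume : Measure E).toSphere.real univ * g 0 := by
  have h1 := tendsto_integral_regularized hs.continuousOn hmono hloc
    (contDiff_laplacian hg b).continuous (hasCompactSupport_laplacian hc b)
  have h3 := (tendsto_integral_remainder_critical hj hg.continuous hc).const_mul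
    (4 * κ * (j + 1))
  have h5 : 2 * κ * (volume : Measure E).toSphere.real univ * g 0 = 4 * κ * (j + 1) *
      ((volume : Measure E).toSphere.real univ / (2 * (j + 1 : ℕ)) * g 0) := by
    have : (j : ℝ) + 1 ≠ 0 := by positivity
    push_cast
    field_simp
    ring
  rw [h5]
  refine tendsto_nhds_unique h1 (h3.congr' ?_)
  filter_upwards [self_mem_nhdsWithin] with a ha
  rw [integral_laplacian_mul_regularized b hψ hs hg hc ha, hj]
  push_cast
  ring

lemma hasDerivAt_pow_inv (j : ℕ) {q : ℝ} (hq : 0 < q) :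
    HasDerivAt (fun q : ℝ => (q ^ j)⁻¹) (-j * (q ^ (j + 1))⁻¹) q := by
  refine ((hasDerivAt_pow j q).fun_inv (pow_ne_zero _ hq.ne')).congr_deriv ?_
  rcases j with _ | j
  · simp
  · push_cast
    field_simp
    simp
    ring

lemma contDiffOn_pow_inv (j : ℕ) : ContDiffOn ℝ ∞ (fun q : ℝ => (q ^ j)⁻¹) (Ioi 0) :=
  (contDiff_id.pow j).contDiffOn.inv fun q (hq : 0 < q) => pow_ne_zero _ hq.ne'

/-- Iterated Laplacians against negative even powers of the norm. -/
lemma integral_laplacian_iterate_mul_pow_inv (b : OrthonormalBasis ι ℝ E) (l i : ℕ)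
    (hk : finrank ℝ E = 2 * (i + l + 2)) {g : E → ℝ} (hg : ContDiff ℝ ∞ g)
    (hc : HasCompactSupport g) :
    (i.factorial : ℝ) * ∫ w, (laplacian b)^[l + 1] g w * ((‖w‖ ^ 2) ^ (i + 1))⁻¹ =
      (-1) ^ (l + 1) * 4 ^ l * 2 * l.factorial * (i + l + 1).factorial *
        (volume : Measure E).toSphere.real univ * g 0 := by
  have hit (l : ℕ) : ContDiff ℝ ∞ ((laplacian b)^[l] g) ∧
      HasCompactSupport ((laplacian b)^[l] g) := by
    induction l with
    | zero => exact ⟨hg, hc⟩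
    | succ l ih =>
      rw [Function.iterate_succ_apply']
      exact ⟨contDiff_laplacian ih.1 b, hasCompactSupport_laplacian ih.2 b⟩
  have hloc (hi : 2 * (i + 1) < finrank ℝ E) :
      LocallyIntegrable (fun w : E => ((‖w‖ ^ 2) ^ (i + 1))⁻¹) := by
    simpa only [← pow_mul] using locallyIntegrable_norm_pow_inv (volume : Measure E) hi
  induction l generalizing i with
  | zero =>
    rw [Function.iterate_succ_apply', integral_laplacian_mul_critical b
      (fun q hq => hasDerivAt_pow_inv (i + 1) hq) (contDiffOn_pow_inv _)
      (Or.inr (antitoneOn_pow_inv _)) (hloc (by omega)) (by omega) (hit 0).1 (hit 0).2]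
    simp [Nat.factorial_succ]
    ring
  | succ l ih =>
    have := ih (i + 1) (by omega) (fun h => by
      simpa only [← pow_mul] using locallyIntegrable_norm_pow_inv (volume : Measure E) h)
    rw [Function.iterate_succ_apply', integral_laplacian_mul_of_lt b
      (fun q hq => hasDerivAt_pow_inv (i + 1) hq) (contDiffOn_pow_inv _)
      (Or.inr (antitoneOn_pow_inv _)) (hloc (by omega)) (by omega) (hit _).1 (hit _).2]
    have e : i + (l + 1) + 1 = i + 1 + l + 1 := by omega
    rw [Nat.factorial_succ i] at this
    rw [e, Nat.factorial_succ l, hk]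
    push_cast at this ⊢
    linear_combination (-4 * ((l : ℝ) + 1)) * this

/-- The logarithm is, up to a constant, a fundamental solution of a power of the Laplacian in even
dimensions. -/
theorem integral_laplacian_iterate_mul_log_norm (b : OrthonormalBasis ι ℝ E) (l : ℕ)
    (hk : finrank ℝ E = 2 * (l + 1)) {g : E → ℝ} (hg : ContDiff ℝ ∞ g)
    (hc : HasCompactSupport g) :
    ∫ w, (laplacian b)^[l + 1] g w * log ‖w‖ =
      (-1) ^ l * 4 ^ l * (l.factorial : ℝ) ^ 2 *
        (volume : Measure E).toSphere.real univ * g 0 := by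
  have hlog (w : E) : log ‖w‖ = (1 / 2) * log (‖w‖ ^ 2) := by
    rw [log_pow]; push_cast; ring
  have hψ : ∀ q : ℝ, 0 < q → HasDerivAt (fun q => 1 / 2 * log q) (1 / 2 * (q ^ (0 + 1))⁻¹) q := by
    intro q hq
    simpa using (hasDerivAt_log hq.ne').const_mul (1 / 2 : ℝ)
  have hs : ContDiffOn ℝ ∞ (fun q => 1 / 2 * log q) (Ioi 0) :=
    contDiffOn_const.mul (contDiffOn_log.mono fun q (hq : 0 < q) => hq.ne')
  have hmono : MonotoneOn (fun q => 1 / 2 * log q) (Ioi 0) := fun a ha c hc h =>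
    mul_le_mul_of_nonneg_left (log_le_log ha h) (by norm_num)
  have hloc : LocallyIntegrable (fun w : E => 1 / 2 * log (‖w‖ ^ 2)) := by
    simpa only [← hlog] using locallyIntegrable_log_norm (volume : Measure E) (by omega)
  simp only [hlog]
  rcases l with _ | l
  · rw [Function.iterate_one, integral_laplacian_mul_critical b hψ hs (Or.inl hmono) hloc (by omega)
      hg hc]
    simp
  · have hit (l : ℕ) : ContDiff ℝ ∞ ((laplacian b)^[l] g) ∧
        HasCompactSupport ((laplacian b)^[l] g) := by
      induction l with
      | zero => exact ⟨hg, hc⟩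
      | succ l ih =>
        rw [Function.iterate_succ_apply']
        exact ⟨contDiff_laplacian ih.1 b, hasCompactSupport_laplacian ih.2 b⟩
    have := integral_laplacian_iterate_mul_pow_inv b l 0 (by omega) hg hc
    rw [Function.iterate_succ_apply', integral_laplacian_mul_of_lt b hψ hs (Or.inl hmono) hloc
      (by omega) (hit _).1 (hit _).2, hk]
    simp only [Nat.factorial_zero, Nat.cast_one, one_mul, zero_add] at this ⊢
    rw [this, Nat.factorial_succ l]
    push_cast
    ring

end FundamentalSolution

section Frullani

variable {E : Type*} [NormedAddCommGroup E] [InnerProductSpace ℝ E]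
variable [FiniteDimensional ℝ E] [MeasurableSpace E] [BorelSpace E] [Nontrivial E]

lemma integrable_frullani_dominator (hd : 1 < finrank ℝ E) (B : ℝ) :
    Integrable (fun q : ℝ × E => (1 + q.1 ^ 2)⁻¹ *
      (closedBall (0 : E) B).indicator (fun w => 1 + ‖w‖⁻¹) q.2)
      ((volume.restrict (Ioi 0)).prod volume) := by
  refine Integrable.mul_prod (f := fun σ : ℝ => (1 + σ ^ 2)⁻¹)
    (g := (closedBall (0 : E) B).indicator (fun w => 1 + ‖w‖⁻¹))
    integrable_inv_one_add_sq.restrict ?_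
  rw [integrable_indicator_iff isClosed_closedBall.measurableSet]
  have h1 := locallyIntegrable_norm_pow_inv (volume : Measure E) hd
  simp only [pow_one] at h1
  exact ((locallyIntegrable_const (1 : ℝ)).add h1).integrableOn_isCompact
    (isCompact_closedBall 0 B)

lemma abs_frullani_le {m : ℝ → ℝ} {B L C R : ℝ} (hL : 0 < L) (hC : 0 < C) (hR : 1 ≤ R)
    (hlip : ∀ σ τ, |m σ - m τ| ≤ L * |σ - τ|) (hbd : ∀ σ, |m σ| ≤ C) (hsupp : ∀ σ, R < σ → m σ = 0)
    {r σ : ℝ} (hr : 0 < r) (hrB : r ≤ B) (hσ : 0 < σ) :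
    |σ⁻¹ * (m (r * σ) - m σ)| ≤
      (L * (B + 1) * (1 + R ^ 2) + 2 * C * R) * ((1 + σ ^ 2)⁻¹ * (1 + r⁻¹)) := by
  have hri : 0 < r⁻¹ := inv_pos.2 hr
  have hB : 0 < B := hr.trans_le hrB
  have hσi : 0 < σ⁻¹ := inv_pos.2 hσ
  rw [abs_mul, abs_of_pos hσi]
  rcases le_or_gt σ R with h | h
  · have h1 : |r * σ - σ| ≤ (B + 1) * σ := by
      rw [abs_le]; constructor <;> nlinarith
    calc σ⁻¹ * |m (r * σ) - m σ| ≤ σ⁻¹ * (L * ((B + 1) * σ)) := by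
          gcongr
          exact (hlip _ _).trans (by gcongr)
      _ = L * (B + 1) * 1 * 1 := by field_simp
      _ ≤ L * (B + 1) * ((1 + R ^ 2) * (1 + σ ^ 2)⁻¹) * (1 + r⁻¹) := by
          gcongr
          · rw [← div_eq_mul_inv, one_le_div (by positivity)]
            gcongr
          · linarith
      _ ≤ _ := by
          have : 0 ≤ 2 * C * R * ((1 + σ ^ 2)⁻¹ * (1 + r⁻¹)) := by positivity
          linarith
  · rw [hsupp σ h, sub_zero]
    rcases le_or_gt (r * σ) R with h' | h'
    · calc σ⁻¹ * |m (r * σ)| ≤ σ⁻¹ * C := by gcongr; exact hbd _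
        _ ≤ 2 * C * R * ((1 + σ ^ 2)⁻¹ * r⁻¹) := by
          rw [inv_mul_eq_div, div_le_iff₀ hσ]
          have e : 2 * C * R * ((1 + σ ^ 2)⁻¹ * r⁻¹) * σ = C * ((2 * R * σ) / ((1 + σ ^ 2) * r)) := by
            field_simp
          rw [e]
          refine le_mul_of_one_le_right hC.le ?_
          rw [one_le_div (by positivity)]
          nlinarith
        _ ≤ 2 * C * R * ((1 + σ ^ 2)⁻¹ * (1 + r⁻¹)) := by gcongr; linarith
        _ ≤ _ := by
          have : 0 ≤ L * (B + 1) * (1 + R ^ 2) * ((1 + σ ^ 2)⁻¹ * (1 + r⁻¹)) := by positivity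
          linarith
    · rw [hsupp _ h', abs_zero, mul_zero]
      positivity

/-- A Frullani-type formula for families of functions with vanishing averages. -/
theorem integral_inv_mul_integral_dilation (hd : 1 < finrank ℝ E) {M : E → ℝ → ℝ} {B L C R : ℝ}
    (hM : Continuous (Function.uncurry M)) (hL : 0 < L) (hC : 0 < C) (hR : 1 ≤ R)
    (hlip : ∀ w σ τ, |M w σ - M w τ| ≤ L * |σ - τ|) (hbd : ∀ w σ, |M w σ| ≤ C)
    (hsupp : ∀ w σ, R < σ → M w σ = 0) (hsupp' : ∀ w σ, B < ‖w‖ → M w σ = 0)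
    (hzero : ∀ σ, ∫ w, M w σ = 0) :
    ∫ σ in Ioi (0 : ℝ), σ⁻¹ * ∫ w, M w (‖w‖ * σ) = -∫ w, M w 0 * log ‖w‖ := by
  have hint {c : E → ℝ} (hc : Continuous c) : Integrable fun w => M w (c w) := by
    refine (hM.comp (continuous_id.prodMk hc)).integrable_of_hasCompactSupport ?_
    refine HasCompactSupport.of_support_subset_isCompact (isCompact_closedBall 0 B) fun w hw => ?_
    by_contra h
    exact hw (hsupp' _ _ (by simpa using h))
  have hne : ∀ᵐ w : E, w ≠ 0 := by simp [ae_iff]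
  have h1 : ∀ σ ∈ Ioi (0 : ℝ), σ⁻¹ * ∫ w, M w (‖w‖ * σ) =
      ∫ w, σ⁻¹ * (M w (‖w‖ * σ) - M w σ) := by
    intro σ _
    rw [integral_const_mul, integral_sub (hint (by fun_prop)) (hint (by fun_prop)), hzero, sub_zero]
  have hN : Integrable (Function.uncurry fun (σ : ℝ) (w : E) => σ⁻¹ * (M w (‖w‖ * σ) - M w σ))
      ((volume.restrict (Ioi 0)).prod volume) := by
    refine ((integrable_frullani_dominator hd B).const_mul
      (L * (B + 1) * (1 + R ^ 2) + 2 * C * R)).mono' ?_ ?_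
    · refine Measurable.aestronglyMeasurable ?_
      refine (measurable_fst.inv).mul (Measurable.sub ?_ ?_)
      · exact (hM.comp (continuous_snd.prodMk (by fun_prop :
          Continuous fun q : ℝ × E => ‖q.2‖ * q.1))).measurable
      · exact (hM.comp (continuous_snd.prodMk continuous_fst)).measurable
    · have hpos : ∀ᵐ q ∂((volume.restrict (Ioi (0 : ℝ))).prod (volume : Measure E)), 0 < q.1 :=
        Measure.quasiMeasurePreserving_fst.ae (ae_restrict_mem measurableSet_Ioi)
      have hne' : ∀ᵐ q ∂((volume.restrict (Ioi (0 : ℝ))).prod (volume : Measure E)), q.2 ≠ 0 :=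
        Measure.quasiMeasurePreserving_snd.ae hne
      filter_upwards [hpos, hne'] with ⟨σ, w⟩ hσ hw
      simp only [Function.uncurry_apply_pair, norm_eq_abs] at hσ hw ⊢
      rcases le_or_gt ‖w‖ B with h | h
      · rw [indicator_of_mem (by simpa using h)]
        exact abs_frullani_le hL hC hR (hlip w) (hbd w) (hsupp w) (norm_pos_iff.2 hw) h hσ
      · rw [hsupp' _ _ h, hsupp' _ _ h, indicator_of_notMem (by simpa using h)]
        simp
  rw [setIntegral_congr_fun measurableSet_Ioi h1, integral_integral_swap hN, ← integral_neg]
  refine integral_congr_ae ?_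
  filter_upwards [hne, hN.prod_left_ae] with w hw hw'
  have hc : Continuous (M w) := hM.comp (continuous_const.prodMk continuous_id)
  have hlim : Tendsto (M w) atTop (𝓝 0) :=
    tendsto_const_nhds.congr' ((eventually_gt_atTop R).mono fun σ hσ => (hsupp w σ hσ).symm)
  have := Frullani.integral_Ioi_eq (f := M w) (a := ‖w‖) (b := 1)
    (hc.locallyIntegrable.locallyIntegrableOn _) (norm_pos_iff.2 hw) one_pos
    ((hc.tendsto 0).mono_left nhdsWithin_le_nhds) hlim
    (by simpa [IntegrableOn, Function.uncurry] using hw')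
  simp only [one_mul, smul_eq_mul, one_div, log_inv, sub_zero] at this
  rw [this]
  ring

/-- The average over the sphere of the values of `H` at height `‖σ e - y n‖`. -/
def sphereAverage (H : E × ℝ → ℝ) (e x : E) (y : ℝ) (w : E) (σ : ℝ) : ℝ :=
  ∫ n, H (x + w, ‖σ • e - y • (n : E)‖) ∂(volume : Measure E).toSphere

omit [Nontrivial E] in
lemma continuous_sphereAverage {H : E × ℝ → ℝ} (hH : Continuous H) (e x : E) (y : ℝ) :
    Continuous (Function.uncurry (sphereAverage H e x y)) := by
  have := continuous_parametric_integral_of_continuous (μ := (volume : Measure E).toSphere)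
    (f := fun (q : E × ℝ) (n : sphere (0 : E) 1) => H (x + q.1, ‖q.2 • e - y • (n : E)‖))
    (by fun_prop) (isCompact_univ)
  simpa [Function.uncurry_def, sphereAverage] using this

omit [Nontrivial E] in
lemma integral_sphereAverage_comp {H : E × ℝ → ℝ} (hH : Continuous H) (hHc : HasCompactSupport H)
    {c : E → E} (hc : Continuous c) (x : E) (y : ℝ) :
    ∫ w, ∫ n, H (x + w, ‖c w - y • (n : E)‖) ∂(volume : Measure E).toSphere =
      ∫ n, (∫ w, H (x + w, ‖c w - y • (n : E)‖)) ∂(volume : Measure E).toSphere := by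
  obtain ⟨B, hB, hs⟩ := exists_bound_support hHc
  refine integral_integral_swap_of_hasCompactSupport
    (f := fun (w : E) (n : sphere (0 : E) 1) => H (x + w, ‖c w - y • (n : E)‖)) (by fun_prop) ?_
  refine HasCompactSupport.of_support_subset_isCompact
    ((isCompact_closedBall (-x) B).prod isCompact_univ) fun q hq => ⟨?_, mem_univ _⟩
  simpa [dist_eq_norm, add_comm] using (hs _ hq).1

omit [Nontrivial E] in
lemma integral_sphere_integral_cone {H : E × ℝ → ℝ} (hH : Continuous H)
    (hHc : HasCompactSupport H) {e : E} (he : ‖e‖ = 1) (x : E) (y : ℝ) {σ : ℝ} (hσ : 0 < σ) :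
    ∫ n, (∫ w, H (x + (y * σ⁻¹) • (n : E) + w, ‖w‖ * σ)) ∂(volume : Measure E).toSphere =
      ∫ w, sphereAverage H e x y w (‖w‖ * σ) := by
  have h1 (n : sphere (0 : E) 1) : ∫ w, H (x + (y * σ⁻¹) • (n : E) + w, ‖w‖ * σ) =
      ∫ w, H (x + w, ‖σ • w - y • (n : E)‖) := by
    rw [← integral_add_left_eq_self (fun w => H (x + w, ‖σ • w - y • (n : E)‖))
      ((y * σ⁻¹) • (n : E))]
    refine integral_congr_ae (.of_forall fun w => ?_)
    have : σ • ((y * σ⁻¹) • (n : E) + w) - y • (n : E) = σ • w := by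
      rw [smul_add, smul_smul, mul_left_comm, mul_inv_cancel₀ hσ.ne', mul_one]
      abel
    simp only [this, norm_smul, norm_eq_abs, abs_of_pos hσ, add_assoc, mul_comm]
  simp only [h1]
  rw [← integral_sphereAverage_comp hH hHc (by fun_prop)]
  refine integral_congr_ae (.of_forall fun w => ?_)
  refine integral_sphere_norm_sub (φ := fun r => H (x + w, r)) ?_ y
  rw [norm_smul, norm_smul, he, norm_mul, norm_norm, mul_one, mul_comm]

/-- The backprojection over all cone angles produces a logarithmic potential. -/
theorem integral_inv_mul_integral_sphere_cone (hd : 1 < finrank ℝ E) {H : E × ℝ → ℝ}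
    (hH : ContDiff ℝ ∞ H) (hHc : HasCompactSupport H) (x : E) {y : ℝ} (hy : 0 < y)
    (hzero : ∀ z, ∫ w, H (x + w, z) = 0) :
    ∫ σ in Ioi (0 : ℝ), σ⁻¹ *
        ∫ n, (∫ w, H (x + (y * σ⁻¹) • (n : E) + w, ‖w‖ * σ)) ∂(volume : Measure E).toSphere =
      -((volume : Measure E).toSphere.real univ * ∫ w, H (x + w, y) * log ‖w‖) := by
  obtain ⟨e, he⟩ := exists_norm_eq E zero_le_one
  obtain ⟨B, hB, hs⟩ := exists_bound_support hHc
  obtain ⟨C, hC, hbd⟩ := exists_bound hH.continuous hHc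
  obtain ⟨L, hL⟩ := hH.lipschitzWith_of_hasCompactSupport hHc (by simp)
  set ν := (volume : Measure E).toSphere with hν
  have hA : 0 ≤ ν.real univ := measureReal_nonneg
  have hcont (w : E) (σ : ℝ) :
      Continuous fun n : sphere (0 : E) 1 => H (x + w, ‖σ • e - y • (n : E)‖) :=
    hH.continuous.comp (by fun_prop)
  have hint (w : E) (σ : ℝ) :
      Integrable (fun n : sphere (0 : E) 1 => H (x + w, ‖σ • e - y • (n : E)‖)) ν :=
    (hcont w σ).integrable_of_hasCompactSupport (HasCompactSupport.of_compactSpace _)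
  rw [setIntegral_congr_fun measurableSet_Ioi fun σ (hσ : 0 < σ) =>
    congrArg (σ⁻¹ * ·) (integral_sphere_integral_cone hH.continuous hHc he x y hσ)]
  rw [integral_inv_mul_integral_dilation hd (continuous_sphereAverage hH.continuous e x y)
    (B := B + ‖x‖) (L := (L + 1) * (ν.real univ + 1)) (C := C * (ν.real univ + 1))
    (R := B + y + 1) (by positivity) (by positivity) (by linarith)]
  · rw [← integral_const_mul]
    congr 1
    refine integral_congr_ae (.of_forall fun w => ?_)
    have hn (n : sphere (0 : E) 1) : ‖y • (n : E)‖ = y := by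
      rw [norm_smul, norm_eq_of_mem_sphere, norm_eq_abs, abs_of_pos hy, mul_one]
    simp only [sphereAverage, zero_smul, zero_sub, norm_neg, hn, integral_const, smul_eq_mul]
    ring
  · intro w σ τ
    rw [sphereAverage, sphereAverage, ← integral_sub (hint w σ) (hint w τ)]
    have := norm_integral_le_of_norm_le_const (μ := ν) (C := L * |σ - τ|)
      (f := fun n : sphere (0 : E) 1 => H (x + w, ‖σ • e - y • (n : E)‖) -
        H (x + w, ‖τ • e - y • (n : E)‖)) (.of_forall fun n => ?_)
    · rw [norm_eq_abs] at this
      refine this.trans ?_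
      have : 0 ≤ |σ - τ| := abs_nonneg _
      have : 0 ≤ L * |σ - τ| := by positivity
      nlinarith
    · refine (hL.norm_sub_le _ _).trans ?_
      gcongr
      rw [Prod.mk_sub_mk, sub_self, Prod.norm_mk, norm_zero, max_eq_right (norm_nonneg _)]
      refine (abs_norm_sub_norm_le _ _).trans ?_
      rw [sub_sub_sub_cancel_right, ← sub_smul, norm_smul, he, mul_one, norm_eq_abs]
  · intro w σ
    have := norm_integral_le_of_norm_le_const (μ := ν) (C := C)
      (f := fun n : sphere (0 : E) 1 => H (x + w, ‖σ • e - y • (n : E)‖))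
      (.of_forall fun n => hbd _)
    rw [norm_eq_abs] at this
    exact this.trans (by nlinarith)
  · intro w σ hσ
    refine integral_eq_zero_of_ae (.of_forall fun n => ?_)
    by_contra h
    have h1 := (hs _ h).2
    have h2 := norm_sub_norm_le (σ • e) (y • (n : E))
    simp only [norm_smul, he, norm_eq_of_mem_sphere, mul_one, norm_eq_abs, abs_norm,
      abs_of_pos hy] at h1 h2
    linarith [le_abs_self σ]
  · intro w σ hw
    refine integral_eq_zero_of_ae (.of_forall fun n => ?_)
    by_contra h
    have h1 := (hs _ h).1
    have h2 := norm_sub_norm_le w (-x)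
    simp only [norm_neg, sub_neg_eq_add, add_comm w x] at h1 h2
    linarith
  · intro σ
    have := integral_sphereAverage_comp hH.continuous hHc (c := fun _ => σ • e) (by fun_prop) x y
    simp only [hzero, integral_zero] at this
    exact this

end Frullani

section Assembly

lemma contDiff_rpow_mul {E : Type*} [NormedAddCommGroup E] [NormedSpace ℝ E] {f : E × ℝ → ℝ}
    (hf : ContDiff ℝ ∞ f) (hfs : tsupport f ⊆ {q : E × ℝ | 0 < q.2}) (p : ℝ) :
    ContDiff ℝ ∞ fun q : E × ℝ => q.2 ^ p * f q := by
  refine contDiff_iff_contDiffAt.2 fun q => ?_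
  by_cases hq : q ∈ tsupport f
  swap
  · refine (contDiffAt_const (c := (0 : ℝ))).congr_of_eventuallyEq ?_
    filter_upwards [(isClosed_tsupport f).isOpen_compl.mem_nhds hq] with q' hq'
    rw [image_eq_zero_of_notMem_tsupport hq', mul_zero]
  have hq : 0 < q.2 := hfs hq
  exact ((contDiffAt_rpow_const_of_ne hq.ne').comp q contDiffAt_snd).mul hf.contDiffAt

lemma toSphere_real_univ {E : Type*} [NormedAddCommGroup E] [InnerProductSpace ℝ E]
    [FiniteDimensional ℝ E] [MeasurableSpace E] [BorelSpace E] [Nontrivial E] {l : ℕ}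
    (hk : finrank ℝ E = 2 * (l + 1)) :
    (volume : Measure E).toSphere.real univ = 2 * π ^ (l + 1) / l.factorial := by
  rw [Measure.toSphere_real_apply_univ, Measure.real,
    InnerProductSpace.volume_ball_of_dim_even hk, hk, Nat.factorial_succ]
  have h0 : (l.factorial : ℝ) ≠ 0 := by positivity
  have h1 : (l : ℝ) + 1 ≠ 0 := by positivity
  rw [ENNReal.ofReal_one, one_pow, one_mul, ENNReal.toReal_ofReal (by positivity)]
  push_cast
  field_simp

/-- Substituting the slope `σ = cot θ` for the opening angle `θ`. -/
lemma integral_Ioo_comp_inv_tan (Φ : ℝ → ℝ) :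
    ∫ θ in Ioo 0 (π / 2), (sin θ ^ 2)⁻¹ * Φ (tan θ)⁻¹ = ∫ σ in Ioi (0 : ℝ), Φ σ := by
  have himg : (fun θ => (tan θ)⁻¹) '' Ioo 0 (π / 2) = Ioi 0 := by
    ext σ
    constructor
    · rintro ⟨θ, hθ, rfl⟩
      exact inv_pos.2 (tan_pos_of_pos_of_lt_pi_div_two hθ.1 hθ.2)
    · intro hσ
      have hσ : 0 < σ := hσ
      exact ⟨arctan σ⁻¹, ⟨arctan_pos.2 (inv_pos.2 hσ), arctan_lt_pi_div_two _⟩, by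
        simp only [tan_arctan, inv_inv]⟩
  have hinj : InjOn (fun θ => (tan θ)⁻¹) (Ioo 0 (π / 2)) := fun a ha c hc h =>
    injOn_tan ⟨by linarith [ha.1, pi_pos], ha.2⟩ ⟨by linarith [hc.1, pi_pos], hc.2⟩ (inv_injective h)
  have hder : ∀ θ ∈ Ioo 0 (π / 2),
      HasDerivWithinAt (fun θ => (tan θ)⁻¹) (-(sin θ ^ 2)⁻¹) (Ioo 0 (π / 2)) θ := by
    intro θ hθ
    have hs : sin θ ≠ 0 := (sin_pos_of_pos_of_lt_pi hθ.1 (by linarith [hθ.2, pi_pos])).ne'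
    have hc : cos θ ≠ 0 := (cos_pos_of_mem_Ioo ⟨by linarith [hθ.1, pi_pos], hθ.2⟩).ne'
    refine (((hasDerivAt_tan hc).fun_inv ?_).congr_deriv ?_).hasDerivWithinAt
    · rw [tan_eq_sin_div_cos]
      exact div_ne_zero hs hc
    · rw [tan_eq_sin_div_cos]
      field_simp
  rw [← himg, integral_image_eq_integral_abs_deriv_smul measurableSet_Ioo hder hinj]
  refine setIntegral_congr_fun measurableSet_Ioo fun θ _ => ?_
  simp only [abs_neg, smul_eq_mul]
  rw [abs_of_nonneg (by positivity)]

variable {d : ℕ}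

/-- The conical Radon transform as an integral over the graph of a cone. -/
lemma coneRadon_eq_integral_cone [Nontrivial (EuclideanSpace ℝ (Fin (d - 1)))] (p : ℝ)
    {f : EuclideanSpace ℝ (Fin (d - 1)) × ℝ → ℝ}
    (hh : Continuous fun q : EuclideanSpace ℝ (Fin (d - 1)) × ℝ => q.2 ^ (-p) * f q)
    (hc : HasCompactSupport fun q : EuclideanSpace ℝ (Fin (d - 1)) × ℝ => q.2 ^ (-p) * f q)
    (u : EuclideanSpace ℝ (Fin (d - 1))) {θ : ℝ} (hθ : θ ∈ Ioo 0 (π / 2)) :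
    coneRadon d p f u θ = cos θ ^ p / sin θ *
      ∫ w : EuclideanSpace ℝ (Fin (d - 1)),
        (‖w‖ * (tan θ)⁻¹) ^ (-p) * f (u + w, ‖w‖ * (tan θ)⁻¹) := by
  have hs : 0 < sin θ := sin_pos_of_pos_of_lt_pi hθ.1 (by linarith [hθ.2, pi_pos])
  have hc' : 0 < cos θ := cos_pos_of_mem_Ioo ⟨by linarith [hθ.1, pi_pos], hθ.2⟩
  rw [← integral_polar volume (integrable_cone hh hc u (tan θ)⁻¹)]
  have hsub := integral_comp_mul_right_Ioi (fun r : ℝ =>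
    r ^ (finrank ℝ (EuclideanSpace ℝ (Fin (d - 1))) - 1) *
      ∫ n : sphere (0 : EuclideanSpace ℝ (Fin (d - 1))) 1,
        (‖r • (n : EuclideanSpace ℝ (Fin (d - 1)))‖ * (tan θ)⁻¹) ^ (-p) *
          f (u + r • (n : EuclideanSpace ℝ (Fin (d - 1))),
            ‖r • (n : EuclideanSpace ℝ (Fin (d - 1)))‖ * (tan θ)⁻¹)
        ∂(volume : Measure (EuclideanSpace ℝ (Fin (d - 1)))).toSphere) 0 hs
  rw [zero_mul, smul_eq_mul] at hsub
  rw [div_eq_mul_inv, mul_assoc, ← hsub, ← integral_const_mul, coneRadon]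
  refine setIntegral_congr_fun measurableSet_Ioi fun s (hs' : 0 < s) => ?_
  have hn (n : sphere (0 : EuclideanSpace ℝ (Fin (d - 1))) 1) :
      ‖(s * sin θ) • (n : EuclideanSpace ℝ (Fin (d - 1)))‖ * (tan θ)⁻¹ = s * cos θ := by
    rw [norm_smul, norm_eq_of_mem_sphere, norm_eq_abs, abs_of_pos (by positivity),
      tan_eq_sin_div_cos]
    field_simp
  have hd : finrank ℝ (EuclideanSpace ℝ (Fin (d - 1))) - 1 = d - 2 := by
    rw [finrank_euclideanSpace_fin]
    omega
  have hpow : cos θ ^ p * (s * cos θ) ^ (-p) = s ^ (-p) := by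
    rw [mul_rpow hs'.le hc'.le, mul_left_comm, ← rpow_add hc', add_neg_cancel, rpow_zero, mul_one]
  simp only [hn, hd, integral_const_mul, integral_mul_const, sphereMeasure, ← hpow]
  ring

lemma lap_eq_laplacian :
    lap d = laplacian fun i => EuclideanSpace.basisFun (Fin (d - 1)) ℝ i := by
  funext h u
  simp only [lap, laplacian, EuclideanSpace.basisFun_apply]

/-- The ambient space of the first argument of the conical Radon transform. -/
abbrev Space (d : ℕ) := EuclideanSpace ℝ (Fin (d - 1))

/-- Local filtered backprojection with the dimension written as `d - 1 = 2 * (l + 1)`. -/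
theorem backprojection_eq {l : ℕ} (hdl : d - 1 = 2 * (l + 1)) (p : ℝ) {f : Space d × ℝ → ℝ}
    (hf : ContDiff ℝ ∞ f) (hfc : HasCompactSupport f)
    (hfs : tsupport f ⊆ {q : Space d × ℝ | 0 < q.2}) (x : Space d) {y : ℝ} (hy : 0 < y) :
    f (x, y) = (-1 : ℝ) ^ (l + 1) * (y ^ p / (2 * π) ^ (d - 1)) *
      ∫ θ in Ioo (0 : ℝ) (π / 2), cos θ ^ (-(1 + p)) *
        ∫ n, ((lap d)^[l + 1] (fun u => coneRadon d p f u θ))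
          (x + (y * tan θ) • (n : Space d)) ∂(sphereMeasure d) := by
  have hdim : finrank ℝ (Space d) = 2 * (l + 1) := by
    rw [finrank_euclideanSpace_fin, hdl]
  have hnt : Nontrivial (Space d) := nontrivial_of_finrank_pos (R := ℝ) (by omega)
  set b := EuclideanSpace.basisFun (Fin (d - 1)) ℝ with hb
  set h : Space d × ℝ → ℝ := fun q => q.2 ^ (-p) * f q with hh_def
  have hh : ContDiff ℝ (⊤ : ℕ∞) h := contDiff_rpow_mul hf hfs (-p)
  have hhc : HasCompactSupport h := hfc.mul_left
  set H := (laplacianFst b)^[l + 1] h with hH_def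
  have hH : ContDiff ℝ (⊤ : ℕ∞) H := contDiff_laplacianFst_iterate hh b (l + 1)
  have hHc : HasCompactSupport H := hasCompactSupport_laplacianFst_iterate hhc b (l + 1)
  have hzero : ∀ z, ∫ w, H (x + w, z) = 0 := by
    intro z
    have h1 := integral_laplacian (μ := (volume : Measure (Space d)))
      (contDiff_slice (contDiff_laplacianFst_iterate hh b l) x z)
      (hasCompactSupport_slice
        (hasCompactSupport_laplacianFst_iterate hhc b l) x z) b
    rw [laplacian_slice (contDiff_laplacianFst_iterate hh b l)] at h1
    rw [hH_def, Function.iterate_succ_apply']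
    exact h1
  have hintegrand : ∀ θ ∈ Ioo (0 : ℝ) (π / 2),
      cos θ ^ (-(1 + p)) *
          ∫ n, ((lap d)^[l + 1] (fun u => coneRadon d p f u θ))
              (x + (y * tan θ) • (n : Space d)) ∂(sphereMeasure d) =
        (sin θ ^ 2)⁻¹ * ((tan θ)⁻¹⁻¹ *
          ∫ n, (∫ w, H (x + (y * (tan θ)⁻¹⁻¹) • (n : Space d) + w, ‖w‖ * (tan θ)⁻¹))
            ∂(volume : Measure (Space d)).toSphere) := by
    intro θ hθ
    have hs : 0 < sin θ := sin_pos_of_pos_of_lt_pi hθ.1 (by linarith [hθ.2, pi_pos])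
    have hc : 0 < cos θ := cos_pos_of_mem_Ioo ⟨by linarith [hθ.1, pi_pos], hθ.2⟩
    have h1 : (fun u => coneRadon d p f u θ) =
        fun u => cos θ ^ p / sin θ * ∫ w : Space d, h (u + w, ‖w‖ * (tan θ)⁻¹) :=
      funext fun u => coneRadon_eq_integral_cone p hh.continuous hhc u hθ
    rw [h1, lap_eq_laplacian, laplacian_iterate_integral_cone hh hhc,
      integral_const_mul, inv_inv, ← mul_assoc, ← mul_assoc]
    congr 1
    rw [rpow_neg hc.le, rpow_add hc, rpow_one, tan_eq_sin_div_cos]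
    have := (rpow_pos_of_pos hc p).ne'
    field_simp
  rw [setIntegral_congr_fun measurableSet_Ioo hintegrand,
    integral_Ioo_comp_inv_tan fun σ => σ⁻¹ *
      ∫ n, (∫ w, H (x + (y * σ⁻¹) • (n : Space d) + w, ‖w‖ * σ)) ∂(volume : Measure (Space d)).toSphere,
    integral_inv_mul_integral_sphere_cone (hdim ▸ by omega) hH hHc x hy hzero]
  have hlog := integral_laplacian_iterate_mul_log_norm b l hdim
    (contDiff_slice hh x y) (hasCompactSupport_slice hhc x y)
  rw [laplacian_iterate_slice hh] at hlog
  rw [hlog, toSphere_real_univ hdim,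
    show (2 * π) ^ (d - 1) = (2 * π) ^ (2 * (l + 1)) by rw [hdl]]
  have hp := (rpow_pos_of_pos hy p).ne'
  have hfact : (l.factorial : ℝ) ≠ 0 := by positivity
  have hsign : (-1 : ℝ) ^ l * (-1) ^ l = 1 := by rw [← mul_pow]; norm_num
  have h4 : (2 : ℝ) ^ (2 * (l + 1)) = 4 * 4 ^ l := by rw [pow_mul, pow_succ]; norm_num; ring
  have hπ : π ^ (2 * (l + 1)) = (π ^ (l + 1)) ^ 2 := by rw [mul_comm, pow_mul]
  simp only [hh_def, add_zero, rpow_neg hy.le]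
  rw [mul_pow, h4, hπ, pow_succ (-1 : ℝ)]
  field_simp
  linear_combination (-4 * f (x, y)) * hsign

end Assembly

end ConeRadon

/-- local filtered back-projection in odd dimensions, angle parametrization:
for odd `d ≥ 3`, `f(x,y) = (-1)^{(d-1)/2} (y^p/(2π)^{d-1}) ∫_0^{π/2} cos θ^{-(1+p)}
∫_{S^{d-2}} (Δ_u^{(d-1)/2} R^(p) f)(x + y tan θ n, θ) dn dθ`. -/
theorem coneRadon_fbp_local_angle (d : ℕ) (hd : 3 ≤ d) (hodd : Odd d) (p : ℝ)
    (f : EuclideanSpace ℝ (Fin (d - 1)) × ℝ → ℝ)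
    (hf : ContDiff ℝ (⊤ : ℕ∞) f) (hfc : HasCompactSupport f)
    (hfs : tsupport f ⊆ {q : EuclideanSpace ℝ (Fin (d - 1)) × ℝ | 0 < q.2})
    (x : EuclideanSpace ℝ (Fin (d - 1))) (y : ℝ) (hy : 0 < y) :
    f (x, y) =
      (-1 : ℝ) ^ ((d - 1) / 2) * (y ^ p / (2 * π) ^ (d - 1)) *
        ∫ θ in Set.Ioo (0 : ℝ) (π / 2),
          Real.cos θ ^ (-(1 + p)) *
            ∫ n, ((lap d)^[(d - 1) / 2] (fun u => coneRadon d p f u θ))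
                (x + (y * Real.tan θ) • (n : EuclideanSpace ℝ (Fin (d - 1))))
              ∂(sphereMeasure d) := by
  obtain ⟨k, rfl⟩ := hodd
  have hk : (2 * k + 1 - 1) / 2 = (k - 1) + 1 := by omega
  rw [hk]
  exact ConeRadon.backprojection_eq (by omega) p hf hfc hfs x hy
end
end

section
/- Let d ≥ 3 be an odd integer and p ∈ ℝ, and let f : ℝ^{d-1} × ℝ → ℝ be smooth with compact support contained in ℝ^{d-1} × (0,∞). Then for every x ∈ ℝ^{d-1} and y > 0: f(x, y) = (−1)^{(d−1)/2} · (1 / (2π)^{d-1}) · ∫_{ℝ^{d-1}} (|u − x|² + y²)^{(p−1)/2} · |u − x|^{-(d-2)} · (Δ_u^{(d−1)/2} R^(p) f)(u, arctan(|u − x| / y)) du, where Δ_u^{(d−1)/2} denotes the (d−1)/2-fold iterated Laplacian of R^(p) f in its first argument. -/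
open MeasureTheory Real Metric
open scoped RealInnerProductSpace

noncomputable section

section GaussianPairing

open scoped SchwartzMap FourierTransform Laplacian LineDeriv

variable {E : Type*} [NormedAddCommGroup E] [InnerProductSpace ℝ E] [FiniteDimensional ℝ E]
  [MeasurableSpace E] [BorelSpace E]

lemma fourierInv_laplacian_apply (h : 𝓢(E, ℂ)) (w : E) :
    𝓕⁻ (Δ h) w = (((-(2 * π * ‖w‖) ^ 2 : ℝ)) : ℂ) * 𝓕⁻ h w := by
  have hi : ∀ i, (inner ℝ · (stdOrthonormalBasis ℝ E i) : E → ℝ).HasTemperateGrowth := by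
    intro i; fun_prop
  have hsum : 𝓕⁻ (Δ h) = ∑ i, 𝓕⁻ (∂_{stdOrthonormalBasis ℝ E i}
      (∂_{stdOrthonormalBasis ℝ E i} h)) := by
    rw [SchwartzMap.laplacian_eq_sum (stdOrthonormalBasis ℝ E)]
    exact map_sum (FourierTransform.fourierInvCLM ℂ 𝓢(E, ℂ)) _ _
  have hn : ‖w‖ ^ 2 = ∑ i, (inner ℝ w (stdOrthonormalBasis ℝ E i)) ^ 2 :=
    ((stdOrthonormalBasis ℝ E).sum_sq_inner_left w).symm
  rw [hsum, sum_apply, mul_pow, hn]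
  push_cast
  rw [Finset.mul_sum, ← Finset.sum_neg_distrib, Finset.sum_mul]
  refine Finset.sum_congr rfl fun i _ => ?_
  rw [SchwartzMap.fourierInv_lineDerivOp_eq, SchwartzMap.fourierInv_lineDerivOp_eq]
  simp only [smul_apply, SchwartzMap.smulLeftCLM_apply_apply (hi i), smul_eq_mul,
    Complex.real_smul]
  ring_nf
  rw [Complex.I_sq]
  ring

lemma fourierInv_laplacian_iterate_apply (m : ℕ) (h : 𝓢(E, ℂ)) (w : E) :
    𝓕⁻ ((fun g : 𝓢(E, ℂ) => Δ g)^[m] h) w =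
      (((-(2 * π * ‖w‖) ^ 2 : ℝ) ^ m : ℝ) : ℂ) * 𝓕⁻ h w := by
  induction m with
  | zero => simp
  | succ m ih =>
    rw [Function.iterate_succ_apply', fourierInv_laplacian_apply, ih, pow_succ]
    push_cast
    ring

lemma integral_mul_gaussian_eq (g : 𝓢(E, ℂ)) {b : ℝ} (hb : 0 < b) :
    ∫ v, g v * ((rexp (-b * ‖v‖ ^ 2) : ℝ) : ℂ) =
      ∫ w, 𝓕⁻ g w * (((π / b) ^ (Module.finrank ℝ E / 2 : ℝ) *
        rexp (-π ^ 2 * ‖w‖ ^ 2 / b) : ℝ) : ℂ) := by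
  have hFint : Integrable (fun v : E => Complex.exp (-(b : ℂ) * (‖v‖ : ℂ) ^ 2)) := by
    simpa using GaussianFourier.integrable_cexp_neg_mul_sq_norm_add (V := E)
      (b := (b : ℂ)) (by simpa using hb) 0 0
  have key := VectorFourier.integral_fourierIntegral_smul_eq_flip (μ := (volume : Measure E))
    (ν := (volume : Measure E)) (e := Real.fourierChar) (L := innerₗ E)
    (f := (𝓕⁻ g : 𝓢(E, ℂ))) (g := fun v : E => Complex.exp (-(b : ℂ) * (‖v‖ : ℂ) ^ 2))
    Real.continuous_fourierChar (by simp only [innerₗ_apply_apply]; fun_prop)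
    (𝓕⁻ g : 𝓢(E, ℂ)).integrable hFint
  have h1 : VectorFourier.fourierIntegral Real.fourierChar (volume : Measure E) (innerₗ E)
      (𝓕⁻ g : 𝓢(E, ℂ)) = g := by
    have : 𝓕 (𝓕⁻ g) = g := FourierTransform.fourier_fourierInv_eq g
    conv_rhs => rw [← this]
    rfl
  have h2 : VectorFourier.fourierIntegral Real.fourierChar (volume : Measure E) (innerₗ E).flip
      (fun v : E => Complex.exp (-(b : ℂ) * (‖v‖ : ℂ) ^ 2)) =
      fun w => (((π / b) ^ (Module.finrank ℝ E / 2 : ℝ) *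
        rexp (-π ^ 2 * ‖w‖ ^ 2 / b) : ℝ) : ℂ) := by
    rw [flip_innerₗ]
    ext w
    have := fourier_gaussian_innerProductSpace (V := E) (b := (b : ℂ)) (by simpa using hb) w
    refine Eq.trans this ?_
    push_cast
    rw [Complex.ofReal_cpow (by positivity)]
    push_cast
    rfl
  rw [h1, h2] at key
  simp only [smul_eq_mul] at key
  rw [← key]
  congr 1 with v
  push_cast
  rfl

lemma integrable_integral_gaussian_dilate [Nontrivial E] {m : ℕ} (hm : Module.finrank ℝ E = 2 * m)
    (h : 𝓢(E, ℂ)) :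
    let Φ : E → ℂ := fun u => ((‖u‖ ^ (2 * m))⁻¹ : ℝ) *
      ∫ v, ((fun g : 𝓢(E, ℂ) => Δ g)^[m] h) v * ((rexp (-(‖v‖ / ‖u‖) ^ 2) : ℝ) : ℂ)
    Integrable Φ ∧ ∫ u, Φ u = (-1) ^ m * (2 * π) ^ (2 * m) * h 0 := by
  intro Φ
  set k : 𝓢(E, ℂ) := 𝓕⁻ h with hk
  let K : E → E → ℂ := fun u w =>
    ((((-1) ^ m * (2 * π) ^ (2 * m) * (π ^ m * ‖w‖ ^ (2 * m)) *
      rexp (-(π ^ 2 * ‖w‖ ^ 2) * ‖u‖ ^ 2) : ℝ)) : ℂ) * k w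
  have hfin : (Module.finrank ℝ E / 2 : ℝ) = (m : ℕ) := by rw [hm]; push_cast; ring
  have hgauss : ∀ w : E, w ≠ 0 → ∫ u : E, rexp (-(π ^ 2 * ‖w‖ ^ 2) * ‖u‖ ^ 2) =
      (π ^ m * ‖w‖ ^ (2 * m))⁻¹ := by
    intro w hw
    have hw' : 0 < ‖w‖ := norm_pos_iff.2 hw
    rw [GaussianFourier.integral_rexp_neg_mul_sq_norm (by positivity), hfin, Real.rpow_natCast]
    have : π / (π ^ 2 * ‖w‖ ^ 2) = (π * ‖w‖ ^ 2)⁻¹ := by field_simp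
    rw [this, inv_pow, mul_pow, pow_mul]
  have hgint : ∀ w : E, w ≠ 0 → Integrable (fun u : E => rexp (-(π ^ 2 * ‖w‖ ^ 2) * ‖u‖ ^ 2)) := by
    intro w hw
    have hw' : 0 < ‖w‖ := norm_pos_iff.2 hw
    by_contra hc
    have := hgauss w hw
    rw [integral_undef hc] at this
    have h2 : 0 < (π ^ m * ‖w‖ ^ (2 * m))⁻¹ := by positivity
    linarith
  have hΦ : ∀ᵐ u : E, Φ u = ∫ w, K u w := by
    filter_upwards [compl_mem_ae_iff.2 (measure_singleton (0 : E))] with u hu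
    have hu' : 0 < ‖u‖ := norm_pos_iff.2 hu
    have hb : 0 < (‖u‖ ^ 2)⁻¹ := by positivity
    have := integral_mul_gaussian_eq ((fun g : 𝓢(E, ℂ) => Δ g)^[m] h) hb
    have e1 : ∀ v : E, rexp (-(‖v‖ / ‖u‖) ^ 2) = rexp (-(‖u‖ ^ 2)⁻¹ * ‖v‖ ^ 2) := by
      intro v; congr 1; field_simp
    simp only [Φ, e1]
    rw [this, ← integral_const_mul]
    congr 1 with w
    rw [fourierInv_laplacian_iterate_apply, hfin, Real.rpow_natCast]
    simp only [K, hk]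
    have e2 : -π ^ 2 * ‖w‖ ^ 2 / (‖u‖ ^ 2)⁻¹ = -(π ^ 2 * ‖w‖ ^ 2) * ‖u‖ ^ 2 := by
      field_simp
    rw [e2]
    have e3 : (‖u‖ ^ (2 * m))⁻¹ * ((-(2 * π * ‖w‖) ^ 2) ^ m * (π / (‖u‖ ^ 2)⁻¹) ^ m) =
        (-1) ^ m * (2 * π) ^ (2 * m) * (π ^ m * ‖w‖ ^ (2 * m)) := by
      have : (-(2 * π * ‖w‖) ^ 2) = (-1) * ((2 * π) ^ 2 * ‖w‖ ^ 2) := by ring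
      rw [this, div_inv_eq_mul, mul_pow, mul_pow, mul_pow _ (‖u‖ ^ 2), pow_mul, pow_mul, pow_mul]
      field_simp
    rw [← e3]
    push_cast
    ring
  have hKae : ∀ᵐ w : E, (∫ u, K u w) = (-1) ^ m * (2 * π) ^ (2 * m) * k w := by
    filter_upwards [compl_mem_ae_iff.2 (measure_singleton (0 : E))] with w hw
    have hw' : 0 < ‖w‖ := norm_pos_iff.2 hw
    simp only [K]
    rw [integral_mul_const, integral_complex_ofReal, integral_const_mul, hgauss w hw,
      mul_inv_cancel_right₀ (by positivity)]
    push_cast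
    ring
  have hKint : Integrable (Function.uncurry K) ((volume : Measure E).prod volume) := by
    have hmeas : AEStronglyMeasurable (Function.uncurry K) ((volume : Measure E).prod volume) := by
      apply Continuous.aestronglyMeasurable
      simp only [K, Function.uncurry_def]
      have := k.continuous
      fun_prop
    rw [integrable_prod_iff' hmeas]
    constructor
    · filter_upwards [compl_mem_ae_iff.2 (measure_singleton (0 : E))] with w hw
      simp only [Function.uncurry, K]
      exact ((hgint w hw).const_mul _).ofReal.mul_const _
    · have : Integrable (fun w => (2 * π) ^ (2 * m) * ‖k w‖) := k.integrable.norm.const_mul _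
      refine this.congr ?_
      filter_upwards [compl_mem_ae_iff.2 (measure_singleton (0 : E))] with w hw
      have hw' : 0 < ‖w‖ := norm_pos_iff.2 hw
      have : ∀ u, ‖Function.uncurry K (u, w)‖ = (2 * π) ^ (2 * m) * (π ^ m * ‖w‖ ^ (2 * m)) * ‖k w‖ *
          rexp (-(π ^ 2 * ‖w‖ ^ 2) * ‖u‖ ^ 2) := by
        intro u
        simp only [Function.uncurry, K, norm_mul, Complex.norm_real, Real.norm_eq_abs, abs_mul,
          abs_pow, abs_neg, abs_one, one_pow, one_mul, Real.abs_exp, abs_norm,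
          abs_of_pos Real.pi_pos, Nat.abs_ofNat]
        ring
      simp only [this]
      rw [integral_const_mul, hgauss w hw]
      field_simp
  have hsum : ∫ w, k w = h 0 := by
    have : 𝓕 k = h := FourierTransform.fourier_fourierInv_eq h
    conv_rhs => rw [← this]
    rw [SchwartzMap.fourier_coe, Real.fourier_eq]
    simp
  constructor
  · exact hKint.integral_prod_left.congr (hΦ.mono fun u hu => hu.symm)
  · rw [integral_congr_ae hΦ, integral_integral_swap hKint, integral_congr_ae hKae,
      integral_const_mul, hsum]

end GaussianPairing

section VertexIntegral

lemma exists_linearIsometryEquiv_apply_eq {E : Type*} [NormedAddCommGroup E]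
    [InnerProductSpace ℝ E] {e w : E} (h : ‖e‖ = ‖w‖) :
    ∃ A : E ≃ₗᵢ[ℝ] E, A e = w :=
  ⟨Submodule.reflection (ℝ ∙ (e - w))ᗮ, Submodule.reflection_sub h⟩

variable {E : Type*} [NormedAddCommGroup E] [InnerProductSpace ℝ E] [FiniteDimensional ℝ E]
  [MeasurableSpace E] [BorelSpace E]

lemma integral_comp_smul_linearIsometryEquiv (A : E ≃ₗᵢ[ℝ] E) {r : ℝ} (hr : 0 < r) (F : E → ℝ) :
    ∫ u, F u = r ^ Module.finrank ℝ E * ∫ u, F (r • A u) := by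
  have h1 : ∫ u, F (r • A u) = ∫ u, F (r • u) :=
    A.measurePreserving.integral_comp A.toHomeomorph.measurableEmbedding (fun u => F (r • u))
  rw [h1, Measure.integral_comp_smul_of_nonneg _ _ _ (hR := hr.le), smul_eq_mul,
    mul_inv_cancel_left₀ (by positivity)]

lemma integrable_comp_smul_linearIsometryEquiv_iff (A : E ≃ₗᵢ[ℝ] E) {r : ℝ} (hr : 0 < r)
    (F : E → ℝ) : Integrable (fun u => F (r • A u)) ↔ Integrable F := by
  rw [← integrable_comp_smul_iff (volume : Measure E) F hr.ne']
  exact A.measurePreserving.integrable_comp_emb A.toHomeomorph.measurableEmbedding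
    (g := fun u => F (r • u))

lemma abs_inv_pow_mul_sub_gaussian_le (n : ℕ) {g : ℝ → ℝ} {T L M : ℝ} (hT : 0 ≤ T) (hL : 0 ≤ L)
    (hgT : ∀ t, T < t → g t = 0) (hgL : ∀ t, |g t - g 1| ≤ L * |t - 1|) (hgM : |g 1| ≤ M)
    {r t : ℝ} (hr : 0 < r) (ht1 : |t - 1| ≤ 1 / r) (ht2 : 1 / r - 1 ≤ t) :
    |(r ^ n)⁻¹ * (g t - g 1 * rexp (-(1 / r) ^ 2))| ≤
      (M * n.factorial + (L + M)) * (T + 2) ^ (n + 1) * (1 + r) ^ (-((n : ℝ) + 1)) := by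
  have hM : 0 ≤ M := (abs_nonneg _).trans hgM
  have hpow : (1 + r) ^ (-((n : ℝ) + 1)) = ((1 + r) ^ (n + 1))⁻¹ := by
    rw [Real.rpow_neg (by positivity)]
    congr 1
    exact_mod_cast Real.rpow_natCast (1 + r) (n + 1)
  rw [hpow, abs_mul, abs_of_pos (show 0 < (r ^ n)⁻¹ by positivity)]
  have hT2 : (1 : ℝ) ≤ (T + 2) ^ (n + 1) := one_le_pow₀ (by linarith)
  rcases lt_or_ge (r * (T + 1)) 1 with hsmall | hbig
  · have ht : T < t := by
      have h1 : T + 1 < 1 / r := by rw [lt_div_iff₀ hr]; linarith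
      linarith
    have hs : (1 / r) ^ n * rexp (-(1 / r) ^ 2) ≤ n.factorial := by
      have h1 : 1 ≤ 1 / r := by
        rw [le_div_iff₀ hr]; nlinarith
      have h2 := Real.pow_div_factorial_le_exp (1 / r) (by positivity) n
      have h3 : rexp (-(1 / r) ^ 2) ≤ rexp (-(1 / r)) := Real.exp_le_exp.2 (by nlinarith)
      rw [div_le_iff₀ (by positivity)] at h2
      calc (1 / r) ^ n * rexp (-(1 / r) ^ 2)
          ≤ (rexp (1 / r) * n.factorial) * rexp (-(1 / r)) := by gcongr
        _ = (rexp (1 / r) * rexp (-(1 / r))) * n.factorial := by ring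
        _ = n.factorial := by rw [← Real.exp_add]; simp
    have h2 : (1 + r) ^ (n + 1) ≤ (T + 2) ^ (n + 1) := by
      have : 1 + r ≤ T + 2 := by nlinarith
      gcongr
    have h4 : 1 ≤ (T + 2) ^ (n + 1) * ((1 + r) ^ (n + 1))⁻¹ := by
      rw [← div_eq_mul_inv, one_le_div₀ (by positivity)]
      exact h2
    rw [hgT t ht, zero_sub, abs_neg, abs_mul, abs_of_pos (Real.exp_pos _)]
    calc (r ^ n)⁻¹ * (|g 1| * rexp (-(1 / r) ^ 2))
        = |g 1| * ((1 / r) ^ n * rexp (-(1 / r) ^ 2)) := by rw [one_div, inv_pow]; ring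
      _ ≤ M * n.factorial := by gcongr
      _ ≤ M * n.factorial + (L + M) := by linarith
      _ ≤ (M * n.factorial + (L + M)) * ((T + 2) ^ (n + 1) * ((1 + r) ^ (n + 1))⁻¹) :=
        le_mul_of_one_le_right (by positivity) h4
      _ = _ := by ring
  · have h1 : |g t - g 1 * rexp (-(1 / r) ^ 2)| ≤ (L + M) * (1 / r) := by
      have hx : 0 ≤ 1 - rexp (-(1 / r) ^ 2) := by
        have : rexp (-(1 / r) ^ 2) ≤ 1 := Real.exp_le_one_iff.2 (by nlinarith [sq_nonneg (1 / r)])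
        linarith
      have hx2 : 1 - rexp (-(1 / r) ^ 2) ≤ 1 / r := by
        have h3 := Real.add_one_le_exp (-(1 / r) ^ 2)
        have h4 := Real.exp_pos (-(1 / r) ^ 2)
        have h5 : 0 < 1 / r := by positivity
        rcases le_or_gt 1 (1 / r) with h | h <;> nlinarith
      calc |g t - g 1 * rexp (-(1 / r) ^ 2)|
          = |(g t - g 1) + g 1 * (1 - rexp (-(1 / r) ^ 2))| := by ring_nf
        _ ≤ |g t - g 1| + |g 1 * (1 - rexp (-(1 / r) ^ 2))| := abs_add_le _ _
        _ = |g t - g 1| + |g 1| * (1 - rexp (-(1 / r) ^ 2)) := by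
          rw [abs_mul, abs_of_nonneg hx]
        _ ≤ L * (1 / r) + M * (1 / r) := by
          gcongr
          exact (hgL t).trans (by gcongr)
        _ = (L + M) * (1 / r) := by ring
    have h2 : 1 + r ≤ (T + 2) * r := by nlinarith
    have h3 : (1 + r) ^ (n + 1) ≤ (T + 2) ^ (n + 1) * r ^ (n + 1) := by
      rw [← mul_pow]; gcongr
    calc (r ^ n)⁻¹ * |g t - g 1 * rexp (-(1 / r) ^ 2)|
        ≤ (r ^ n)⁻¹ * ((L + M) * (1 / r)) := by gcongr
      _ = (L + M) * (r ^ (n + 1))⁻¹ := by rw [pow_succ]; field_simp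
      _ ≤ (L + M) * ((T + 2) ^ (n + 1) * ((1 + r) ^ (n + 1))⁻¹) := by
        gcongr
        rw [inv_le_iff_one_le_mul₀ (by positivity)]
        field_simp
        linarith
      _ ≤ (M * n.factorial + (L + M)) * ((T + 2) ^ (n + 1) * ((1 + r) ^ (n + 1))⁻¹) := by
        have : 0 ≤ M * n.factorial := by positivity
        exact mul_le_mul_of_nonneg_right (by linarith) (by positivity)
      _ = _ := by ring

lemma integrable_integral_vertex_sub_gaussian [Nontrivial E] {G : E → ℝ → ℝ}
    (hG : Continuous (Function.uncurry G)) {R T L M : ℝ} (hT : 0 ≤ T) (hL : 0 ≤ L)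
    (hGR : ∀ v t, R < ‖v‖ → G v t = 0) (hGT : ∀ v t, T < t → G v t = 0)
    (hGL : ∀ v t, |G v t - G v 1| ≤ L * |t - 1|) (hGM : ∀ v, |G v 1| ≤ M)
    (hG0 : ∀ t, ∫ v, G v t = 0) :
    let Φ : E → ℝ := fun u => ∫ v, (‖u‖ ^ Module.finrank ℝ E)⁻¹ *
      (G v (‖v - u‖ / ‖u‖) - G v 1 * rexp (-(‖v‖ / ‖u‖) ^ 2))
    Integrable Φ ∧ ∫ u, Φ u = 0 := by
  intro Φ
  obtain ⟨e, he⟩ := exists_norm_eq E zero_le_one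
  set n := Module.finrank ℝ E with hn
  let K : E → E → ℝ := fun u v => (‖u‖ ^ n)⁻¹ *
      (G v (‖v - u‖ / ‖u‖) - G v 1 * rexp (-(‖v‖ / ‖u‖) ^ 2))
  let K₁ : E → E → ℝ := fun u v => (‖u‖ ^ n)⁻¹ *
      (G v (‖e - u‖ / ‖u‖) - G v 1 * rexp (-(1 / ‖u‖) ^ 2))
  have hGc : ∀ v, Continuous (G v) := fun v => hG.comp (by fun_prop : Continuous fun t => (v, t))
  have hGm : ∀ {α : Type _} [MeasurableSpace α] (a : α → E) (b : α → ℝ), Measurable a →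
      Measurable b → Measurable fun x => G (a x) (b x) := fun a b ha hb =>
    hG.measurable.comp (ha.prodMk hb)
  have hKm : Measurable (Function.uncurry K) := by
    simp only [K, Function.uncurry_def]
    refine Measurable.mul (by fun_prop) (Measurable.sub ?_ (Measurable.mul ?_ (by fun_prop)))
    · exact hGm _ _ (by fun_prop) (by fun_prop)
    · exact hGm _ _ (by fun_prop) (by fun_prop)
  have hK₁m : Measurable (Function.uncurry K₁) := by
    simp only [K₁, Function.uncurry_def]
    refine Measurable.mul (by fun_prop) (Measurable.sub ?_ (Measurable.mul ?_ (by fun_prop)))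
    · exact hGm _ _ (by fun_prop) (by fun_prop)
    · exact hGm _ _ (by fun_prop) (by fun_prop)
  let C : ℝ := (M * n.factorial + (L + M)) * (T + 2) ^ (n + 1)
  let B : E → ℝ := fun u => C * (1 + ‖u‖) ^ (-((n : ℝ) + 1))
  have hBint : Integrable B := (integrable_one_add_norm (by rw [hn]; linarith)).const_mul _
  have hball : Integrable ((closedBall (0 : E) R).indicator fun _ => (1 : ℝ)) :=
    (integrable_indicator_iff measurableSet_closedBall).2
      (integrableOn_const (measure_closedBall_lt_top.ne))
  have hK₁0 : ∀ u v, R < ‖v‖ → K₁ u v = 0 := by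
    intro u v hv
    simp [K₁, hGR v _ hv]
  have hae : ∀ᵐ u : E, u ≠ 0 := compl_mem_ae_iff.2 (measure_singleton (0 : E))
  have hK₁b : ∀ u v, u ≠ 0 →
      ‖K₁ u v‖ ≤ B u * (closedBall (0 : E) R).indicator (fun _ => (1 : ℝ)) v := by
    intro u v hu
    by_cases hv : R < ‖v‖
    · have : v ∉ closedBall (0 : E) R := by simpa using hv
      simp [hK₁0 u v hv, this]
    · have : v ∈ closedBall (0 : E) R := by simpa using hv
      have hr : 0 < ‖u‖ := norm_pos_iff.2 hu
      rw [Set.indicator_of_mem this, mul_one, Real.norm_eq_abs]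
      refine abs_inv_pow_mul_sub_gaussian_le n hT hL (hGT v) (hGL v) (hGM v) hr ?_ ?_
      · have h1 := abs_norm_sub_norm_le (e - u) (-u)
        rw [norm_neg, sub_neg_eq_add, sub_add_cancel, he] at h1
        rw [show ‖e - u‖ / ‖u‖ - 1 = (‖e - u‖ - ‖u‖) / ‖u‖ by field_simp, abs_div,
          abs_of_pos hr]
        gcongr
      · have h1 := norm_sub_norm_le e u
        rw [he] at h1
        rw [show 1 / ‖u‖ - 1 = (1 - ‖u‖) / ‖u‖ by field_simp]
        gcongr
  have hK₁int : Integrable (Function.uncurry K₁) ((volume : Measure E).prod volume) := by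
    refine (hBint.mul_prod hball).mono' hK₁m.aestronglyMeasurable ?_
    have : ∀ᵐ z : E × E ∂((volume : Measure E).prod volume), z.1 ≠ 0 :=
      Measure.quasiMeasurePreserving_fst.ae hae
    filter_upwards [this] with z hz
    exact hK₁b z.1 z.2 hz
  have hscale : ∀ v : E, v ≠ 0 → ∃ A : E ≃ₗᵢ[ℝ] E, ∀ u, K (‖v‖ • A u) v =
      (‖v‖ ^ n)⁻¹ * K₁ u v := by
    intro v hv
    have hv' : 0 < ‖v‖ := norm_pos_iff.2 hv
    obtain ⟨A, hA⟩ := exists_linearIsometryEquiv_apply_eq (e := e) (w := ‖v‖⁻¹ • v)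
      (by rw [he, norm_smul, norm_inv, norm_norm, inv_mul_cancel₀ hv'.ne'])
    refine ⟨A, fun u => ?_⟩
    have h1 : ‖‖v‖ • A u‖ = ‖v‖ * ‖u‖ := by rw [norm_smul, norm_norm, A.norm_map]
    have h2 : ‖v - ‖v‖ • A u‖ = ‖v‖ * ‖e - u‖ := by
      have : v - ‖v‖ • A u = ‖v‖ • A (e - u) := by
        rw [map_sub, hA, smul_sub, smul_inv_smul₀ hv'.ne']
      rw [this, norm_smul, norm_norm, A.norm_map]
    simp only [K, K₁, h1, h2]
    rw [mul_div_mul_left _ _ hv'.ne', mul_pow, mul_inv, mul_assoc]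
    congr 5
    field_simp
  have hKint1 : ∀ᵐ v : E, Integrable (fun u => K u v) := by
    filter_upwards [hae, hK₁int.prod_left_ae] with v hv hv1
    obtain ⟨A, hA⟩ := hscale v hv
    rw [← integrable_comp_smul_linearIsometryEquiv_iff A (norm_pos_iff.2 hv)]
    simp only [hA]
    exact hv1.const_mul _
  have hKeq : ∀ᵐ v : E, ∫ u, K u v = ∫ u, K₁ u v := by
    filter_upwards [hae] with v hv
    have hv' : 0 < ‖v‖ := norm_pos_iff.2 hv
    obtain ⟨A, hA⟩ := hscale v hv
    rw [integral_comp_smul_linearIsometryEquiv A hv' (fun u => K u v)]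
    simp only [hA]
    rw [integral_const_mul, mul_inv_cancel_left₀ (by positivity)]
  have hKeq' : ∀ᵐ v : E, ∫ u, ‖K₁ u v‖ = ∫ u, ‖K u v‖ := by
    filter_upwards [hae] with v hv
    have hv' : 0 < ‖v‖ := norm_pos_iff.2 hv
    obtain ⟨A, hA⟩ := hscale v hv
    rw [integral_comp_smul_linearIsometryEquiv A hv' (fun u => ‖K u v‖)]
    simp only [hA, norm_mul, norm_inv, norm_pow, norm_norm]
    rw [integral_const_mul, mul_inv_cancel_left₀ (by positivity)]
  have hKint : Integrable (Function.uncurry K) ((volume : Measure E).prod volume) := by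
    rw [integrable_prod_iff' hKm.aestronglyMeasurable]
    exact ⟨hKint1, hK₁int.integral_norm_prod_right.congr hKeq'⟩
  refine ⟨hKint.integral_prod_left, ?_⟩
  change ∫ u, ∫ v, K u v = 0
  rw [integral_integral_swap hKint, integral_congr_ae hKeq, ← integral_integral_swap hK₁int]
  have hGint : ∀ t, Integrable fun v => G v t := by
    intro t
    refine Continuous.integrable_of_hasCompactSupport
      (hG.comp (by fun_prop : Continuous fun v : E => (v, t))) ?_
    refine HasCompactSupport.intro (isCompact_closedBall (0 : E) R) fun v hv => ?_
    exact hGR v t (by simpa using hv)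
  have : ∀ u, ∫ v, K₁ u v = 0 := by
    intro u
    simp only [K₁]
    rw [integral_const_mul, integral_sub (hGint _) ((hGint _).mul_const _), integral_mul_const,
      hG0, hG0]
    simp
  simp [this]

end VertexIntegral

section Polar

lemma integral_eq_integral_Ioi_sphere {E : Type*} [NormedAddCommGroup E] [NormedSpace ℝ E]
    [FiniteDimensional ℝ E] [MeasurableSpace E] [BorelSpace E] [Nontrivial E]
    (μ : Measure E) [μ.IsAddHaarMeasure] {F : E → ℝ} (hF : Integrable F μ) :
    ∫ w, F w ∂μ = ∫ r in Set.Ioi (0 : ℝ), r ^ (Module.finrank ℝ E - 1) *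
      ∫ n, F (r • (n : E)) ∂μ.toSphere := by
  have hmp := μ.measurePreserving_homeomorphUnitSphereProd
  have hemb := (homeomorphUnitSphereProd E).measurableEmbedding
  let g : sphere (0 : E) 1 × Set.Ioi (0 : ℝ) → ℝ := fun z => F ((z.2 : ℝ) • (z.1 : E))
  have hg : ∀ x : ({0}ᶜ : Set E), g (homeomorphUnitSphereProd E x) = F x := by
    intro x
    have := congrArg Subtype.val ((homeomorphUnitSphereProd E).symm_apply_apply x)
    rw [homeomorphUnitSphereProd_symm_apply_coe] at this
    simp only [g, this]
  have hgint : Integrable g (μ.toSphere.prod (.volumeIoiPow (Module.finrank ℝ E - 1))) := by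
    rw [← hmp.integrable_comp_emb hemb]
    have : g ∘ homeomorphUnitSphereProd E = F ∘ ((↑) : ({0}ᶜ : Set E) → E) := funext hg
    rw [this, ← integrableOn_iff_comap_subtypeVal (measurableSet_singleton _).compl]
    exact hF.integrableOn
  calc ∫ w, F w ∂μ = ∫ x : ({(0)}ᶜ : Set E), F x ∂(μ.comap (↑)) := by
        rw [integral_subtype_comap (measurableSet_singleton _).compl F,
          restrict_compl_singleton]
    _ = ∫ x, g x ∂μ.toSphere.prod (.volumeIoiPow (Module.finrank ℝ E - 1)) := by
      rw [← hmp.integral_comp hemb]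
      exact integral_congr_ae (Filter.Eventually.of_forall fun x => (hg x).symm)
    _ = ∫ r : Set.Ioi (0 : ℝ), ∫ n, F ((r : ℝ) • (n : E)) ∂μ.toSphere
          ∂(.volumeIoiPow (Module.finrank ℝ E - 1)) := integral_prod_symm _ hgint
    _ = _ := by
      simp only [Measure.volumeIoiPow, ENNReal.ofReal]
      rw [integral_withDensity_eq_integral_smul,
        integral_subtype_comap measurableSet_Ioi fun a : ℝ =>
          Real.toNNReal (a ^ (Module.finrank ℝ E - 1)) • ∫ n, F (a • (n : E)) ∂μ.toSphere]
      · refine setIntegral_congr_fun measurableSet_Ioi fun x hx => ?_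
        simp only [NNReal.smul_def, Real.coe_toNNReal _ (pow_nonneg (le_of_lt hx) _), smul_eq_mul]
      · exact (measurable_subtype_coe.pow_const _).real_toNNReal

lemma contDiff_rpow_mul_of_tsupport_subset {E : Type*} [NormedAddCommGroup E] [NormedSpace ℝ E]
    {f : E × ℝ → ℝ} (hf : ContDiff ℝ (⊤ : ℕ∞) f)
    (hfs : tsupport f ⊆ {q : E × ℝ | 0 < q.2}) (a : ℝ) :
    ContDiff ℝ (⊤ : ℕ∞) (fun q : E × ℝ => q.2 ^ a * f q) := by
  refine contDiff_iff_contDiffAt.2 fun q => ?_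
  by_cases hq : q ∈ tsupport f
  · have : q.2 ≠ 0 := (hfs hq).ne'
    exact (contDiffAt_snd.rpow_const_of_ne this).mul hf.contDiffAt
  · have : (fun q : E × ℝ => q.2 ^ a * f q) =ᶠ[nhds q] fun _ => 0 := by
      filter_upwards [(isClosed_tsupport f).isOpen_compl.mem_nhds hq] with z hz
      simp [image_eq_zero_of_notMem_tsupport hz]
    exact contDiffAt_const.congr_of_eventuallyEq this

end Polar

section ConeIntegral

lemma exists_zero_outside_ball_of_hasCompactSupport {V F : Type*} [NormedAddCommGroup V]
    [Zero F] {q : V → F} (hqc : HasCompactSupport q) :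
    ∃ b : ℝ, 0 ≤ b ∧ ∀ z, b < ‖z‖ → q z = 0 := by
  obtain ⟨b, hb⟩ := hqc.isCompact.isBounded.exists_norm_le
  refine ⟨max b 0, le_max_right _ _, fun z hz => ?_⟩
  by_contra h
  exact absurd (hb z (subset_tsupport _ h)) (by linarith [le_max_left b 0])

variable {E : Type*} [NormedAddCommGroup E] [NormedSpace ℝ E] [FiniteDimensional ℝ E]
  [MeasurableSpace E] [BorelSpace E] (μ : Measure E) [IsFiniteMeasureOnCompacts μ]

lemma integrable_cone {F : Type*} [NormedAddCommGroup F] {q : E × ℝ → F} (hq : Continuous q)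
    (hqc : HasCompactSupport q) {c : ℝ} (hc : 0 < c) (v : E) :
    Integrable (fun w : E => q (v + w, c * ‖w‖)) μ := by
  obtain ⟨b, hb0, hb⟩ := exists_zero_outside_ball_of_hasCompactSupport hqc
  refine Continuous.integrable_of_hasCompactSupport (hq.comp (by fun_prop)) ?_
  refine HasCompactSupport.intro (isCompact_closedBall (0 : E) (b / c)) fun w hw =>
    hb _ ((norm_snd_le _).trans_lt' ?_)
  rw [mem_closedBall_zero_iff, not_le, div_lt_iff₀ hc] at hw
  rw [norm_mul, norm_norm, norm_of_nonneg hc.le]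
  linarith

lemma hasFDerivAt_integral_cone {q : E × ℝ → ℝ} (hq : ContDiff ℝ (⊤ : ℕ∞) q)
    (hqc : HasCompactSupport q) {c : ℝ} (hc : 0 < c) (v : E) :
    HasFDerivAt (fun v => ∫ w : E, q (v + w, c * ‖w‖) ∂μ)
      (∫ w : E, (fderiv ℝ q (v + w, c * ‖w‖)).comp (ContinuousLinearMap.inl ℝ E ℝ) ∂μ) v := by
  have hdc : HasCompactSupport (fderiv ℝ q) := hqc.fderiv ℝ
  have hdcont : Continuous (fderiv ℝ q) := hq.continuous_fderiv (by simp)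
  obtain ⟨b, hb0, hb⟩ := exists_zero_outside_ball_of_hasCompactSupport hdc
  obtain ⟨M, hM⟩ := hdc.exists_bound_of_continuous hdcont
  have hM0 : 0 ≤ M := (norm_nonneg _).trans (hM 0)
  refine hasFDerivAt_integral_of_dominated_of_fderiv_le (s := Set.univ)
    (bound := (closedBall (0 : E) (b / c)).indicator
      fun _ => M * ‖ContinuousLinearMap.inl ℝ E ℝ‖)
    (F' := fun v w => (fderiv ℝ q (v + w, c * ‖w‖)).comp (ContinuousLinearMap.inl ℝ E ℝ))
    Filter.univ_mem ?_ (integrable_cone μ hq.continuous hqc hc v) ?_ ?_ ?_ ?_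
  · exact Filter.Eventually.of_forall fun v =>
      (integrable_cone μ hq.continuous hqc hc v).aestronglyMeasurable
  · apply Continuous.aestronglyMeasurable
    have : Continuous fun w : E => fderiv ℝ q (v + w, c * ‖w‖) := hdcont.comp (by fun_prop)
    exact this.clm_comp continuous_const
  · refine Filter.Eventually.of_forall fun w v _ => ?_
    by_cases hw : w ∈ closedBall (0 : E) (b / c)
    · rw [Set.indicator_of_mem hw]
      exact (ContinuousLinearMap.opNorm_comp_le _ _).trans (by gcongr; exact hM _)
    · rw [Set.indicator_of_notMem hw, hb _ ((norm_snd_le _).trans_lt' ?_)]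
      · simp
      · rw [mem_closedBall_zero_iff, not_le, div_lt_iff₀ hc] at hw
        rw [norm_mul, norm_norm, norm_of_nonneg hc.le]
        linarith
  · exact (integrable_indicator_iff measurableSet_closedBall).2
      (integrableOn_const (measure_closedBall_lt_top.ne))
  · refine Filter.Eventually.of_forall fun w v _ => ?_
    have h1 : HasFDerivAt q (fderiv ℝ q (v + w, c * ‖w‖)) (v + w, c * ‖w‖) :=
      (hq.differentiable (by simp) _).hasFDerivAt
    have h2 : HasFDerivAt (fun v : E => (v + w, c * ‖w‖)) (ContinuousLinearMap.inl ℝ E ℝ) v :=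
      ((hasFDerivAt_id v).add_const w).prodMk (hasFDerivAt_const (c * ‖w‖) v)
    exact h1.comp v h2

lemma fderiv_integral_cone_apply {q : E × ℝ → ℝ} (hq : ContDiff ℝ (⊤ : ℕ∞) q)
    (hqc : HasCompactSupport q) {c : ℝ} (hc : 0 < c) (v e : E) :
    fderiv ℝ (fun v => ∫ w : E, q (v + w, c * ‖w‖) ∂μ) v e =
      ∫ w : E, fderiv ℝ q (v + w, c * ‖w‖) (e, 0) ∂μ := by
  have hdc : HasCompactSupport (fderiv ℝ q) := hqc.fderiv ℝ
  have hdcont : Continuous (fderiv ℝ q) := hq.continuous_fderiv (by simp)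
  have hi := integrable_cone μ hdcont hdc hc v
  have hi2 : Integrable (fun w : E =>
      (fderiv ℝ q (v + w, c * ‖w‖)).comp (ContinuousLinearMap.inl ℝ E ℝ)) μ :=
    ((ContinuousLinearMap.compL ℝ E (E × ℝ) ℝ).flip (ContinuousLinearMap.inl ℝ E ℝ)).integrable_comp
      hi
  rw [(hasFDerivAt_integral_cone μ hq hqc hc v).fderiv, ContinuousLinearMap.integral_apply hi2]
  simp

end ConeIntegral

section FirstLaplacian

/-- The Laplacian of `q` with respect to its first argument, as a function of both arguments. -/
def fstLap (d : ℕ) (q : EuclideanSpace ℝ (Fin (d - 1)) × ℝ → ℝ)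
    (z : EuclideanSpace ℝ (Fin (d - 1)) × ℝ) : ℝ :=
  ∑ i : Fin (d - 1),
    fderiv ℝ (fun z' => fderiv ℝ q z' (EuclideanSpace.single i (1 : ℝ), 0)) z
      (EuclideanSpace.single i (1 : ℝ), 0)

lemma contDiff_fderiv_apply_const {V : Type*} [NormedAddCommGroup V] [NormedSpace ℝ V]
    {q : V → ℝ} (hq : ContDiff ℝ (⊤ : ℕ∞) q) (e : V) :
    ContDiff ℝ (⊤ : ℕ∞) fun z => fderiv ℝ q z e :=
  (hq.fderiv_right (m := (⊤ : ℕ∞)) (by simp)).clm_apply contDiff_const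

lemma hasCompactSupport_fderiv_apply_const {V : Type*} [NormedAddCommGroup V] [NormedSpace ℝ V]
    {q : V → ℝ} (hq : HasCompactSupport q) (e : V) :
    HasCompactSupport fun z => fderiv ℝ q z e :=
  hq.fderiv_apply (𝕜 := ℝ) e

variable {d : ℕ} {q : EuclideanSpace ℝ (Fin (d - 1)) × ℝ → ℝ}

lemma ContDiff.fstLap (hq : ContDiff ℝ (⊤ : ℕ∞) q) : ContDiff ℝ (⊤ : ℕ∞) (fstLap d q) :=
  ContDiff.sum fun _ _ => contDiff_fderiv_apply_const (contDiff_fderiv_apply_const hq _) _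

lemma HasCompactSupport.fstLap (hq : HasCompactSupport q) : HasCompactSupport (fstLap d q) := by
  have h : _root_.fstLap d q = ∑ i : Fin (d - 1), fun z =>
      fderiv ℝ (fun z' => fderiv ℝ q z' (EuclideanSpace.single i (1 : ℝ), 0)) z
      (EuclideanSpace.single i (1 : ℝ), 0) := by
    ext z; simp [_root_.fstLap]
  rw [h]
  exact Finset.sum_induction _ HasCompactSupport (fun _ _ h1 h2 => h1.add h2) HasCompactSupport.zero
    fun i _ => hasCompactSupport_fderiv_apply_const (hasCompactSupport_fderiv_apply_const hq _) _

lemma ContDiff.fstLap_iterate (hq : ContDiff ℝ (⊤ : ℕ∞) q) (m : ℕ) :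
    ContDiff ℝ (⊤ : ℕ∞) ((_root_.fstLap d)^[m] q) := by
  induction m generalizing q with
  | zero => exact hq
  | succ m ih => exact ih hq.fstLap

lemma HasCompactSupport.fstLap_iterate (hq : HasCompactSupport q) (m : ℕ) :
    HasCompactSupport ((_root_.fstLap d)^[m] q) := by
  induction m generalizing q with
  | zero => exact hq
  | succ m ih => exact ih hq.fstLap

lemma lap_const_mul (a : ℝ) (h : EuclideanSpace ℝ (Fin (d - 1)) → ℝ) :
    lap d (fun v => a * h v) = fun v => a * lap d h v := by
  ext u
  have key : ∀ g : EuclideanSpace ℝ (Fin (d - 1)) → ℝ, ∀ v e,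
      fderiv ℝ (fun v => a * g v) v e = a * fderiv ℝ g v e := fun g v e => by
    have := fderiv_const_smul_field (𝕜 := ℝ) (f := g) a
    exact congrArg (fun L : _ → _ →L[ℝ] ℝ => L v e) this
  simp only [lap, key, Finset.mul_sum]

lemma lap_iterate_const_mul (m : ℕ) (a : ℝ) (h : EuclideanSpace ℝ (Fin (d - 1)) → ℝ) :
    (lap d)^[m] (fun v => a * h v) = fun v => a * (lap d)^[m] h v := by
  induction m generalizing h with
  | zero => rfl
  | succ m ih => rw [Function.iterate_succ_apply, lap_const_mul, ih]; rfl

lemma lap_integral_cone (hq : ContDiff ℝ (⊤ : ℕ∞) q) (hqc : HasCompactSupport q) {c : ℝ}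
    (hc : 0 < c) :
    lap d (fun v => ∫ w, q (v + w, c * ‖w‖)) = fun v => ∫ w, fstLap d q (v + w, c * ‖w‖) := by
  ext u
  simp only [lap, fstLap]
  rw [integral_finsetSum]
  · refine Finset.sum_congr rfl fun i _ => ?_
    simp only [fderiv_integral_cone_apply _ hq hqc hc]
    rw [fderiv_integral_cone_apply _ (contDiff_fderiv_apply_const hq _)
      (hasCompactSupport_fderiv_apply_const hqc _) hc]
  · intro i _
    exact integrable_cone _ (contDiff_fderiv_apply_const
      (contDiff_fderiv_apply_const hq _) _).continuous (hasCompactSupport_fderiv_apply_const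
      (hasCompactSupport_fderiv_apply_const hqc _) _) hc u

lemma lap_iterate_integral_cone (m : ℕ) (hq : ContDiff ℝ (⊤ : ℕ∞) q) (hqc : HasCompactSupport q)
    {c : ℝ} (hc : 0 < c) :
    (lap d)^[m] (fun v => ∫ w, q (v + w, c * ‖w‖)) =
      fun v => ∫ w, (fstLap d)^[m] q (v + w, c * ‖w‖) := by
  induction m generalizing q with
  | zero => rfl
  | succ m ih =>
    rw [Function.iterate_succ_apply, lap_integral_cone hq hqc hc, ih hq.fstLap hqc.fstLap]; rfl

open scoped Laplacian SchwartzMap in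
lemma laplacian_schwartz_eq_fstLap (hq : ContDiff ℝ (⊤ : ℕ∞) q)
    (x : EuclideanSpace ℝ (Fin (d - 1))) (y : ℝ) (φ : 𝓢(EuclideanSpace ℝ (Fin (d - 1)), ℂ))
    (h : ∀ v, φ v = ((q (x + v, y) : ℝ) : ℂ)) (v : EuclideanSpace ℝ (Fin (d - 1))) :
    (Δ φ) v = ((fstLap d q (x + v, y) : ℝ) : ℂ) := by
  have key : ∀ (g : EuclideanSpace ℝ (Fin (d - 1)) × ℝ → ℝ), ContDiff ℝ (⊤ : ℕ∞) g →
      ∀ (ψ : 𝓢(EuclideanSpace ℝ (Fin (d - 1)), ℂ)), (∀ v, ψ v = ((g (x + v, y) : ℝ) : ℂ)) →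
      ∀ e v, (LineDeriv.lineDerivOp e ψ : 𝓢(EuclideanSpace ℝ (Fin (d - 1)), ℂ)) v =
        ((fderiv ℝ g (x + v, y) (e, 0) : ℝ) : ℂ) := by
    intro g hg ψ hψ e v
    rw [SchwartzMap.lineDerivOp_apply_eq_fderiv]
    have h1 : HasFDerivAt (fun v => (x + v, y)) (ContinuousLinearMap.inl ℝ _ ℝ) v :=
      ((hasFDerivAt_id v).const_add x).prodMk (hasFDerivAt_const y v)
    have h2 : HasFDerivAt g (fderiv ℝ g (x + v, y)) (x + v, y) :=
      (hg.differentiable (by simp) _).hasFDerivAt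
    have h3 := Complex.ofRealCLM.hasFDerivAt.comp v (h2.comp v h1)
    have h4 : (ψ : EuclideanSpace ℝ (Fin (d - 1)) → ℂ) =
      Complex.ofRealCLM ∘ g ∘ fun v => (x + v, y) := funext hψ
    rw [h4, h3.fderiv]
    simp
  rw [SchwartzMap.laplacian_eq_sum (EuclideanSpace.basisFun (Fin (d - 1)) ℝ), fstLap]
  push_cast
  rw [Finset.sum_apply]
  refine Finset.sum_congr rfl fun i _ => ?_
  rw [EuclideanSpace.basisFun_apply]
  exact key _ (contDiff_fderiv_apply_const hq _) _ (key q hq φ h _) _ v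

open scoped Laplacian SchwartzMap in
lemma laplacian_iterate_schwartz_eq_fstLap (m : ℕ) (hq : ContDiff ℝ (⊤ : ℕ∞) q)
    (x : EuclideanSpace ℝ (Fin (d - 1))) (y : ℝ) (φ : 𝓢(EuclideanSpace ℝ (Fin (d - 1)), ℂ))
    (h : ∀ v, φ v = ((q (x + v, y) : ℝ) : ℂ)) (v : EuclideanSpace ℝ (Fin (d - 1))) :
    ((fun g : 𝓢(EuclideanSpace ℝ (Fin (d - 1)), ℂ) => Δ g)^[m] φ) v =
      (((fstLap d)^[m] q (x + v, y) : ℝ) : ℂ) := by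
  induction m generalizing q φ with
  | zero => exact h v
  | succ m ih =>
    exact ih hq.fstLap _ (laplacian_schwartz_eq_fstLap hq x y φ h)

end FirstLaplacian

lemma coneRadon_eq_integral_cone {d : ℕ} (hd : 2 ≤ d) (p : ℝ)
    (f : EuclideanSpace ℝ (Fin (d - 1)) × ℝ → ℝ) (v : EuclideanSpace ℝ (Fin (d - 1))) {θ : ℝ}
    (hs : 0 < sin θ) (hc : 0 < cos θ)
    (hFint : Integrable fun w => (fun z : EuclideanSpace ℝ (Fin (d - 1)) × ℝ =>
      z.2 ^ (-p) * f z) (v + w, cos θ / sin θ * ‖w‖)) :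
    coneRadon d p f v θ = (sin θ)⁻¹ * cos θ ^ p *
      ∫ w, (fun z : EuclideanSpace ℝ (Fin (d - 1)) × ℝ => z.2 ^ (-p) * f z)
        (v + w, cos θ / sin θ * ‖w‖) := by
  have : Nonempty (Fin (d - 1)) := ⟨⟨0, by omega⟩⟩
  rw [integral_eq_integral_Ioi_sphere _ hFint]
  have hsub := integral_comp_mul_right_Ioi (fun r => r ^ (d - 2) *
    ∫ n : sphere (0 : EuclideanSpace ℝ (Fin (d - 1))) 1,
      (fun z : EuclideanSpace ℝ (Fin (d - 1)) × ℝ => z.2 ^ (-p) * f z)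
        (v + r • (n : EuclideanSpace ℝ (Fin (d - 1))), cos θ / sin θ * r) ∂sphereMeasure d) 0 hs
  rw [zero_mul, smul_eq_mul] at hsub
  have hright : (∫ r in Set.Ioi (0 : ℝ),
      r ^ (Module.finrank ℝ (EuclideanSpace ℝ (Fin (d - 1))) - 1) *
        ∫ n : sphere (0 : EuclideanSpace ℝ (Fin (d - 1))) 1,
          (fun z : EuclideanSpace ℝ (Fin (d - 1)) × ℝ => z.2 ^ (-p) * f z)
            (v + r • (n : EuclideanSpace ℝ (Fin (d - 1))),
              cos θ / sin θ * ‖r • (n : EuclideanSpace ℝ (Fin (d - 1)))‖)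
            ∂(volume : Measure (EuclideanSpace ℝ (Fin (d - 1)))).toSphere) =
      ∫ r in Set.Ioi (0 : ℝ), r ^ (d - 2) *
        ∫ n : sphere (0 : EuclideanSpace ℝ (Fin (d - 1))) 1,
          (fun z : EuclideanSpace ℝ (Fin (d - 1)) × ℝ => z.2 ^ (-p) * f z)
            (v + r • (n : EuclideanSpace ℝ (Fin (d - 1))), cos θ / sin θ * r)
            ∂sphereMeasure d := by
    refine setIntegral_congr_fun measurableSet_Ioi fun r hr => ?_
    have hr' : ∀ n : sphere (0 : EuclideanSpace ℝ (Fin (d - 1))) 1,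
        ‖r • (n : EuclideanSpace ℝ (Fin (d - 1)))‖ = r := fun n => by
      rw [norm_smul, norm_eq_of_mem_sphere, mul_one, norm_of_nonneg (le_of_lt hr)]
    simp only [hr', sphereMeasure, finrank_euclideanSpace_fin]
    rfl
  rw [hright, mul_right_comm, ← hsub, ← integral_mul_const]
  refine setIntegral_congr_fun measurableSet_Ioi fun s hspos => ?_
  have hs0 : (0 : ℝ) < s := hspos
  have h1 : cos θ / sin θ * (s * sin θ) = s * cos θ := by field_simp
  simp only [h1]
  rw [← integral_const_mul, ← integral_const_mul, ← integral_mul_const]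
  refine integral_congr_ae (Filter.Eventually.of_forall fun n => ?_)
  have h2 : (s * cos θ) ^ (-p) * cos θ ^ p = s ^ (-p) := by
    rw [mul_rpow hs0.le hc.le, mul_assoc, ← rpow_add hc]; simp
  simp only [← h2]
  ring

lemma cos_arctan_div_sin_arctan {ρ y : ℝ} (hρ : 0 < ρ) (hy : 0 < y) :
    cos (arctan (ρ / y)) / sin (arctan (ρ / y)) = y / ρ := by
  rw [sin_arctan, cos_arctan]
  have : 0 < √(1 + (ρ / y) ^ 2) := by positivity
  field_simp

lemma rpow_mul_inv_sin_arctan_mul_cos_arctan_rpow {ρ y : ℝ} (hρ : 0 < ρ) (hy : 0 < y) (p : ℝ)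
    {d : ℕ} (hd : 1 ≤ d) :
    (ρ ^ 2 + y ^ 2) ^ ((p - 1) / 2) * ρ ^ ((2 : ℝ) - d) *
      ((sin (arctan (ρ / y)))⁻¹ * cos (arctan (ρ / y)) ^ p) = y ^ p * (ρ ^ (d - 1))⁻¹ := by
  have hr : 0 < √(ρ ^ 2 + y ^ 2) := by positivity
  have h1 : √(1 + (ρ / y) ^ 2) = √(ρ ^ 2 + y ^ 2) / y := by
    rw [eq_div_iff hy.ne', ← sqrt_sq hy.le, ← sqrt_mul (by positivity), sqrt_sq hy.le]
    congr 1; field_simp; ring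
  have h2 : (ρ ^ 2 + y ^ 2) ^ ((p - 1) / 2) = √(ρ ^ 2 + y ^ 2) ^ p * (√(ρ ^ 2 + y ^ 2))⁻¹ := by
    rw [← rpow_neg_one, ← rpow_add hr, sqrt_eq_rpow, ← rpow_mul (by positivity)]
    congr 1; ring
  have h3 : ρ ^ ((2 : ℝ) - d) = ρ * (ρ ^ (d - 1))⁻¹ := by
    rw [← rpow_natCast, ← rpow_neg hρ.le, Nat.cast_sub hd]
    nth_rw 2 [← rpow_one ρ]
    rw [← rpow_add hρ]
    congr 1; push_cast; ring
  rw [sin_arctan, cos_arctan, h1, h2, h3, one_div_div, div_rpow hy.le hr.le]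
  have := rpow_pos_of_pos hr p
  field_simp

section VertexAssembly

variable {d : ℕ} {q : EuclideanSpace ℝ (Fin (d - 1)) × ℝ → ℝ}

lemma integrable_slice_vertex (hq : Continuous q) (hqc : HasCompactSupport q)
    (x : EuclideanSpace ℝ (Fin (d - 1))) {φ : EuclideanSpace ℝ (Fin (d - 1)) → ℝ}
    (hφ : Continuous φ) : Integrable fun v => q (x + v, φ v) := by
  obtain ⟨b, -, hb⟩ := exists_zero_outside_ball_of_hasCompactSupport hqc
  refine (hq.comp (by fun_prop : Continuous fun v => (x + v, φ v))).integrable_of_hasCompactSupport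
    (HasCompactSupport.intro (isCompact_closedBall 0 (b + ‖x‖)) fun v hv => hb _ ?_)
  rw [mem_closedBall_zero_iff, not_le] at hv
  have h1 : ‖x + v‖ ≤ ‖(x + v, φ v)‖ := norm_fst_le (x + v, φ v)
  have h2 : ‖v‖ ≤ ‖x + v‖ + ‖x‖ := by simpa using norm_sub_le (x + v) x
  linarith

lemma integrable_slice_vertex_sub_gaussian (hd : 2 ≤ d) (hq : ContDiff ℝ (⊤ : ℕ∞) q)
    (hqc : HasCompactSupport q) (x : EuclideanSpace ℝ (Fin (d - 1))) {y : ℝ} (hy : 0 < y)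
    (hq0 : ∀ t, ∫ v, q (x + v, t) = 0) :
    let Φ : EuclideanSpace ℝ (Fin (d - 1)) → ℝ := fun u => ∫ v, (‖u‖ ^ (d - 1))⁻¹ *
      (q (x + v, y * (‖v - u‖ / ‖u‖)) - q (x + v, y) * rexp (-(‖v‖ / ‖u‖) ^ 2))
    Integrable Φ ∧ ∫ u, Φ u = 0 := by
  have : Nonempty (Fin (d - 1)) := ⟨⟨0, by omega⟩⟩
  obtain ⟨b, hb0, hb⟩ := exists_zero_outside_ball_of_hasCompactSupport hqc
  obtain ⟨M, hM⟩ := hqc.exists_bound_of_continuous hq.continuous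
  obtain ⟨K, hK⟩ := ContDiff.lipschitzWith_of_hasCompactSupport hqc hq (by simp)
  have hqcont := hq.continuous
  have key := integrable_integral_vertex_sub_gaussian (G := fun v t => q (x + v, y * t))
    (hqcont.comp (by fun_prop)) (R := b + ‖x‖) (T := b / y) (L := K * y) (M := M)
    (by positivity) (by positivity) ?_ ?_ ?_ (fun v => hM _) (fun t => hq0 (y * t))
  · simpa only [mul_one, finrank_euclideanSpace_fin] using key
  · intro v t hv
    refine hb _ ?_
    have h1 : ‖x + v‖ ≤ ‖(x + v, y * t)‖ := norm_fst_le (x + v, y * t)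
    have h2 : ‖v‖ ≤ ‖x + v‖ + ‖x‖ := by simpa using norm_sub_le (x + v) x
    linarith
  · intro v t ht
    refine hb _ ?_
    have h1 : ‖y * t‖ ≤ ‖(x + v, y * t)‖ := norm_snd_le (x + v, y * t)
    rw [div_lt_iff₀ hy] at ht
    have h2 : y * t ≤ ‖y * t‖ := le_abs_self _
    linarith
  · intro v t
    have h := hK.dist_le_mul (x + v, y * t) (x + v, y * 1)
    rw [Real.dist_eq, dist_eq_norm, Prod.mk_sub_mk, sub_self, Prod.norm_mk, norm_zero, ← mul_sub,
      norm_mul, norm_of_nonneg hy.le, max_eq_right (by positivity), ← mul_assoc] at h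
    exact h

open scoped SchwartzMap in
lemma exists_schwartzMap_slice (hq : ContDiff ℝ (⊤ : ℕ∞) q) (hqc : HasCompactSupport q)
    (x : EuclideanSpace ℝ (Fin (d - 1))) (t : ℝ) :
    ∃ φ : 𝓢(EuclideanSpace ℝ (Fin (d - 1)), ℂ), ∀ v, φ v = ((q (x + v, t) : ℝ) : ℂ) := by
  obtain ⟨b, -, hb⟩ := exists_zero_outside_ball_of_hasCompactSupport hqc
  have h1 : HasCompactSupport fun v => ((q (x + v, t) : ℝ) : ℂ) := by
    refine HasCompactSupport.intro (isCompact_closedBall 0 (b + ‖x‖)) fun v hv => ?_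
    rw [mem_closedBall_zero_iff, not_le] at hv
    rw [hb, Complex.ofReal_zero]
    have h1 : ‖x + v‖ ≤ ‖(x + v, t)‖ := norm_fst_le (x + v, t)
    have h2 : ‖v‖ ≤ ‖x + v‖ + ‖x‖ := by simpa using norm_sub_le (x + v) x
    linarith
  have h2 : ContDiff ℝ (⊤ : ℕ∞) fun v => ((q (x + v, t) : ℝ) : ℂ) :=
    Complex.ofRealCLM.contDiff.comp (hq.comp (by fun_prop))
  exact ⟨h1.toSchwartzMap h2, fun v => rfl⟩

open scoped SchwartzMap in
lemma integral_fstLap_iterate_eq_zero (hq : ContDiff ℝ (⊤ : ℕ∞) q) (hqc : HasCompactSupport q)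
    (x : EuclideanSpace ℝ (Fin (d - 1))) (t : ℝ) {m : ℕ} (hm : m ≠ 0) :
    ∫ v, (fstLap d)^[m] q (x + v, t) = 0 := by
  obtain ⟨φ, hφ⟩ := exists_schwartzMap_slice hq hqc x t
  have h := fourierInv_laplacian_iterate_apply m φ 0
  rw [SchwartzMap.fourierInv_coe, Real.fourierInv_eq] at h
  simp only [inner_zero_right, laplacian_iterate_schwartz_eq_fstLap m hq x t φ hφ] at h
  simp [hm, integral_complex_ofReal] at h
  exact_mod_cast h

lemma integrable_slice_gaussian {m : ℕ} (hm : m ≠ 0) (hd : d - 1 = 2 * m)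
    (hq : ContDiff ℝ (⊤ : ℕ∞) q) (hqc : HasCompactSupport q)
    (x : EuclideanSpace ℝ (Fin (d - 1))) (y : ℝ) :
    let Φ : EuclideanSpace ℝ (Fin (d - 1)) → ℝ := fun u => (‖u‖ ^ (d - 1))⁻¹ *
      ∫ v, (fstLap d)^[m] q (x + v, y) * rexp (-(‖v‖ / ‖u‖) ^ 2)
    Integrable Φ ∧ ∫ u, Φ u = (-1) ^ m * (2 * π) ^ (d - 1) * q (x, y) := by
  intro Φ
  have : Nonempty (Fin (d - 1)) := ⟨⟨0, by omega⟩⟩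
  obtain ⟨φ, hφ⟩ := exists_schwartzMap_slice hq hqc x y
  obtain ⟨h1, h2⟩ := integrable_integral_gaussian_dilate
    (by rw [finrank_euclideanSpace_fin, hd] : Module.finrank ℝ (EuclideanSpace ℝ (Fin (d - 1))) =
      2 * m) φ
  simp only [laplacian_iterate_schwartz_eq_fstLap m hq x y φ hφ, ← Complex.ofReal_mul,
    integral_complex_ofReal, ← hd] at h1 h2
  refine ⟨h1.re, ?_⟩
  rw [hφ, add_zero] at h2
  exact_mod_cast h2

lemma integral_slice_vertex {m : ℕ} (hm : m ≠ 0) (hd : d - 1 = 2 * m)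
    (hq : ContDiff ℝ (⊤ : ℕ∞) q) (hqc : HasCompactSupport q)
    (x : EuclideanSpace ℝ (Fin (d - 1))) {y : ℝ} (hy : 0 < y) :
    ∫ u, (‖u‖ ^ (d - 1))⁻¹ * ∫ v, (fstLap d)^[m] q (x + v, y * (‖v - u‖ / ‖u‖)) =
      (-1) ^ m * (2 * π) ^ (d - 1) * q (x, y) := by
  have hq' := hq.fstLap_iterate (d := d) m
  have hqc' := hqc.fstLap_iterate (d := d) m
  obtain ⟨h1, h2⟩ := integrable_slice_vertex_sub_gaussian (by omega) hq' hqc' x hy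
    fun t => integral_fstLap_iterate_eq_zero hq hqc x t hm
  obtain ⟨h3, h4⟩ := integrable_slice_gaussian hm hd hq hqc x y
  have hsum := integral_add h1 h3
  rw [h2, h4, zero_add] at hsum
  rw [← hsum]
  refine integral_congr_ae (Filter.Eventually.of_forall fun u => ?_)
  have hi1 := integrable_slice_vertex hq'.continuous hqc' x
    (by fun_prop : Continuous fun v => y * (‖v - u‖ / ‖u‖))
  have hi2 : Integrable fun v => (fstLap d)^[m] q (x + v, y) * rexp (-(‖v‖ / ‖u‖) ^ 2) := by
    refine (integrable_slice_vertex hq'.continuous hqc' x continuous_const).mul_bdd (c := 1)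
      (Continuous.aestronglyMeasurable (by fun_prop)) (Filter.Eventually.of_forall fun v => ?_)
    rw [norm_of_nonneg (exp_pos _).le, exp_le_one_iff, neg_nonpos]
    positivity
  simp only
  rw [integral_const_mul, integral_sub hi1 hi2]
  ring

end VertexAssembly

/-- local filtered back-projection in odd dimensions, vertex parametrization:
for odd `d ≥ 3`, `f(x,y) = (-1)^{(d-1)/2} (2π)^{1-d} ∫_{ℝ^{d-1}} (|u-x|²+y²)^{(p-1)/2}
|u-x|^{-(d-2)} (Δ_u^{(d-1)/2} R^(p) f)(u, arctan(|u-x|/y)) du`. -/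
theorem coneRadon_fbp_local_vertex (d : ℕ) (hd : 3 ≤ d) (hodd : Odd d) (p : ℝ)
    (f : EuclideanSpace ℝ (Fin (d - 1)) × ℝ → ℝ)
    (hf : ContDiff ℝ (⊤ : ℕ∞) f) (hfc : HasCompactSupport f)
    (hfs : tsupport f ⊆ {q : EuclideanSpace ℝ (Fin (d - 1)) × ℝ | 0 < q.2})
    (x : EuclideanSpace ℝ (Fin (d - 1))) (y : ℝ) (hy : 0 < y) :
    f (x, y) =
      (-1 : ℝ) ^ ((d - 1) / 2) * (1 / (2 * π) ^ (d - 1)) *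
        ∫ u, (‖u - x‖ ^ 2 + y ^ 2) ^ ((p - 1) / 2) * ‖u - x‖ ^ ((2 : ℝ) - d) *
          ((lap d)^[(d - 1) / 2]
              (fun v => coneRadon d p f v (Real.arctan (‖u - x‖ / y)))) u := by
  obtain ⟨m, hdm⟩ : ∃ m, d - 1 = 2 * m := by
    obtain ⟨k, rfl⟩ := hodd
    exact ⟨k, by omega⟩
  have hm : m ≠ 0 := by omega
  have hm2 : (d - 1) / 2 = m := by omega
  have : Nonempty (Fin (d - 1)) := ⟨⟨0, by omega⟩⟩
  rw [hm2]
  let Q : EuclideanSpace ℝ (Fin (d - 1)) × ℝ → ℝ := fun z => z.2 ^ (-p) * f z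
  have hQ : ContDiff ℝ (⊤ : ℕ∞) Q := contDiff_rpow_mul_of_tsupport_subset hf hfs _
  have hQc : HasCompactSupport Q := hfc.mul_left
  have hpoint : ∀ u : EuclideanSpace ℝ (Fin (d - 1)), u ≠ 0 →
      (‖u + x - x‖ ^ 2 + y ^ 2) ^ ((p - 1) / 2) * ‖u + x - x‖ ^ ((2 : ℝ) - d) *
          ((lap d)^[m] (fun v => coneRadon d p f v (Real.arctan (‖u + x - x‖ / y)))) (u + x) =
      y ^ p * ((‖u‖ ^ (d - 1))⁻¹ *
        ∫ v, (fstLap d)^[m] Q (x + v, y * (‖v - u‖ / ‖u‖))) := by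
    intro u hu
    have hρ : 0 < ‖u‖ := norm_pos_iff.2 hu
    have hc : 0 < y / ‖u‖ := div_pos hy hρ
    rw [add_sub_cancel_right]
    have hcone : (fun v => coneRadon d p f v (arctan (‖u‖ / y))) = fun v =>
        ((sin (arctan (‖u‖ / y)))⁻¹ * cos (arctan (‖u‖ / y)) ^ p) *
          ∫ w, Q (v + w, y / ‖u‖ * ‖w‖) := by
      ext v
      have hs : 0 < sin (arctan (‖u‖ / y)) := by rw [sin_arctan]; positivity
      rw [coneRadon_eq_integral_cone (by omega) p f v hs (cos_arctan_pos _)]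
      · rw [cos_arctan_div_sin_arctan hρ hy]
      · rw [cos_arctan_div_sin_arctan hρ hy]
        exact integrable_cone _ hQ.continuous hQc hc v
    rw [hcone, lap_iterate_const_mul, lap_iterate_integral_cone m hQ hQc hc, ← mul_assoc,
      rpow_mul_inv_sin_arctan_mul_cos_arctan_rpow hρ hy p (by omega), mul_assoc]
    beta_reduce
    rw [← integral_sub_right_eq_self
        (fun w => (fstLap d)^[m] Q (u + x + w, y / ‖u‖ * ‖w‖)) u]
    congr 2
    refine integral_congr_ae (Filter.Eventually.of_forall fun v => ?_)
    have h1 : u + x + (v - u) = x + v := by abel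
    have h2 : y / ‖u‖ * ‖v - u‖ = y * (‖v - u‖ / ‖u‖) := by ring
    simp only [h1, h2]
  rw [← integral_add_right_eq_self _ x,
    integral_congr_ae ((volume.ae_ne (0 : EuclideanSpace ℝ (Fin (d - 1)))).mono hpoint),
    integral_const_mul, integral_slice_vertex hm hdm hQ hQc x hy]
  have h1 : y ^ p * y ^ (-p) = 1 := by rw [← rpow_add hy]; simp
  have h2 : ((-1 : ℝ) ^ m) * (-1) ^ m = 1 := by rw [← mul_pow]; simp
  have h3 : (2 * π) ^ (d - 1) ≠ 0 := by positivity
  calc f (x, y) = ((-1 : ℝ) ^ m * (-1) ^ m) * ((1 / (2 * π) ^ (d - 1)) * (2 * π) ^ (d - 1)) *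
        (y ^ p * y ^ (-p)) * f (x, y) := by rw [h1, h2, one_div, inv_mul_cancel₀ h3]; ring
    _ = _ := by simp only [Q]; ring
end
end

section
/- Let d ≥ 2 be an integer and p ∈ ℝ, and let f : ℝ^{d-1} × ℝ → ℝ be smooth with compact support contained in ℝ^{d-1} × (0,∞). Then for every θ ∈ (0, π/2), the function k ↦ (F R^(p) f)(k, θ) on ℝ^{d-1} is such that k ↦ |k|^{d-1} · (F R^(p) f)(k, θ) is absolutely integrable over ℝ^{d-1}; in particular k ↦ (F R^(p) f)(k, θ) itself is absolutely integrable over ℝ^{d-1}. -/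
open MeasureTheory Real Metric
open scoped RealInnerProductSpace

noncomputable section

/-- A superposition of translates of a smooth compactly supported function, with weights
integrable on the parameter space, is smooth. -/
theorem HasCompactSupport.contDiff_integral_translate {G α : Type*} [NormedAddCommGroup G]
    [NormedSpace ℝ G] [MeasurableSpace G] [BorelSpace G] [MeasurableSpace α] {ρ : Measure α}
    {T : α → G} {w f : G → ℝ} {m : ℕ∞} (hfc : HasCompactSupport f) (hf : ContDiff ℝ m f)
    (hfm : ∀ x, AEStronglyMeasurable (fun t => f (x - t)) (ρ.map T))
    (hT : Measurable T) (hw : AEStronglyMeasurable w (ρ.map T))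
    (hwT : Integrable (fun a => w (T a)) ρ) :
    ContDiff ℝ m (fun x => ∫ a, w (T a) * f (x - T a) ∂ρ) := by
  have hwi : Integrable w (ρ.map T) := (integrable_map_measure hw hT.aemeasurable).2 hwT
  have h := hfc.contDiff_convolution_right (ContinuousLinearMap.mul ℝ ℝ)
    hwi.locallyIntegrable hf
  convert h using 2 with x
  exact (integral_map hT.aemeasurable (hw.mul (hfm x))).symm

/-- The Fourier transform of a smooth compactly supported function, against any power of the
frequency, is integrable. -/
theorem integrable_norm_pow_mul_fourierFirst {d : ℕ}
    {g : EuclideanSpace ℝ (Fin (d - 1)) → ℝ → ℝ} {θ : ℝ}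
    (hgc : HasCompactSupport fun u => g u θ) (hg : ContDiff ℝ (⊤ : ℕ∞) fun u => g u θ) (n : ℕ) :
    Integrable fun k : EuclideanSpace ℝ (Fin (d - 1)) =>
      ((‖k‖ ^ n : ℝ) : ℂ) * fourierFirst d g k θ := by
  have hc : HasCompactSupport fun u => (g u θ : ℂ) := hgc.comp_left Complex.ofReal_zero
  have hs : ContDiff ℝ (⊤ : ℕ∞) fun u => (g u θ : ℂ) := Complex.ofRealCLM.contDiff.comp hg
  set F := FourierTransform.fourier (hc.toSchwartzMap hs) with hF
  have key : ∀ k, fourierFirst d g k θ = F ((2 * π)⁻¹ • k) := by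
    intro k
    rw [hF, SchwartzMap.fourier_coe, Real.fourier_eq']
    refine integral_congr_ae (Filter.Eventually.of_forall fun u => ?_)
    simp only [smul_eq_mul, inner_smul_right]
    congr 2
    rw [real_inner_comm]
    have : (π : ℂ) ≠ 0 := by exact_mod_cast Real.pi_ne_zero
    push_cast
    field_simp
  have h0 : (2 * π)⁻¹ ≠ 0 := by positivity
  have hi : Integrable fun k : EuclideanSpace ℝ (Fin (d - 1)) =>
      ((‖k‖ ^ n : ℝ) : ℂ) * F k := by
    refine (F.integrable_pow_mul volume n).mono ?_ (Filter.Eventually.of_forall fun k => by simp)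
    exact ((Complex.continuous_ofReal.comp (continuous_norm.pow n)).mul
      F.continuous).aestronglyMeasurable
  refine ((hi.comp_smul h0).const_mul (((2 * π) ^ n : ℝ) : ℂ)).congr
    (Filter.Eventually.of_forall fun k => ?_)
  simp only [key, norm_smul, ← mul_assoc, ← Complex.ofReal_mul]
  rw [← mul_pow, ← mul_assoc, norm_of_nonneg (by positivity),
    mul_inv_cancel₀ (by positivity), one_mul]

theorem hasCompactSupport_coneRadon (d : ℕ) (p : ℝ)
    {f : EuclideanSpace ℝ (Fin (d - 1)) × ℝ → ℝ} (hfc : HasCompactSupport f)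
    {θ : ℝ} (hc : Real.cos θ ≠ 0) :
    HasCompactSupport fun u => coneRadon d p f u θ := by
  refine HasCompactSupport.intro (K := (fun x : (EuclideanSpace ℝ (Fin (d - 1)) × ℝ) ×
      EuclideanSpace ℝ (Fin (d - 1)) => x.1.1 - (x.1.2 / Real.cos θ * Real.sin θ) • x.2) ''
      (tsupport f ×ˢ sphere 0 1)) ?_ ?_
  · exact (hfc.isCompact.prod (isCompact_sphere 0 1)).image (by fun_prop)
  · intro u hu
    have h0 : ∀ (s : ℝ) (n : sphere (0 : EuclideanSpace ℝ (Fin (d - 1))) 1),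
        f (u + (s * Real.sin θ) • (n : EuclideanSpace ℝ (Fin (d - 1))), s * Real.cos θ) = 0 := by
      intro s n
      by_contra h
      refine hu ⟨((_, _), n), ⟨subset_tsupport f h, n.2⟩, ?_⟩
      simp [mul_div_cancel_right₀ _ hc]
    simp [coneRadon, h0]

theorem contDiff_coneRadon (d : ℕ) (p : ℝ)
    {f : EuclideanSpace ℝ (Fin (d - 1)) × ℝ → ℝ} {m : ℕ∞}
    (hf : ContDiff ℝ m f) (hfc : HasCompactSupport f)
    (hfs : tsupport f ⊆ {q : EuclideanSpace ℝ (Fin (d - 1)) × ℝ | 0 < q.2})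
    {θ : ℝ} (hc : 0 < Real.cos θ) :
    ContDiff ℝ m fun u => coneRadon d p f u θ := by
  have : IsFiniteMeasure (sphereMeasure d) := by unfold sphereMeasure; infer_instance
  set S : Set ℝ := (fun q => q.2 / Real.cos θ) '' tsupport f
  have hSc : IsCompact S := hfc.isCompact.image (by fun_prop)
  have hS0 : S ⊆ Set.Ioi 0 := by
    rintro _ ⟨q, hq, rfl⟩
    exact div_pos (hfs hq) hc
  have hfS : ∀ s ∉ S, ∀ x, f (x, s * Real.cos θ) = 0 := by
    intro s hs x
    by_contra h
    exact hs ⟨_, subset_tsupport f h, mul_div_cancel_right₀ _ hc.ne'⟩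
  have : IsFiniteMeasure (volume.restrict S) := ⟨by simpa using hSc.measure_lt_top⟩
  set ρ := (volume.restrict S).prod (sphereMeasure d)
  set v : ℝ → ℝ := fun s => s ^ (-p) * (s * Real.sin θ) ^ (d - 2) with hv
  have hvm : Measurable v := by fun_prop
  have hvi : Integrable v (volume.restrict S) := by
    refine ContinuousOn.integrableOn_compact hSc ?_
    refine ContinuousOn.mul (fun s hs => ?_) (by fun_prop)
    exact (Real.continuousAt_rpow_const _ _ (Or.inl (hS0 hs).ne')).continuousWithinAt
  set T : ℝ × sphere (0 : EuclideanSpace ℝ (Fin (d - 1))) 1 → EuclideanSpace ℝ (Fin (d - 1)) × ℝ :=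
    fun a => (-((a.1 * Real.sin θ) • (a.2 : EuclideanSpace ℝ (Fin (d - 1)))),
      -(a.1 * Real.cos θ)) with hT
  have hTc : Continuous T := by fun_prop
  set w : EuclideanSpace ℝ (Fin (d - 1)) × ℝ → ℝ := fun t => v (-t.2 / Real.cos θ) with hw
  have hwT : ∀ a, w (T a) = v a.1 := by
    intro a
    simp [hw, hT, mul_div_cancel_right₀ _ hc.ne']
  have hvρ : Integrable (fun a => v a.1) ρ := hvi.comp_fst _
  have hsm := hfc.contDiff_integral_translate (ρ := ρ) (T := T) (w := w) hf
    (fun x => (hf.continuous.comp (by fun_prop)).aestronglyMeasurable) hTc.measurable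
    (by fun_prop) (by simpa only [hwT] using hvρ)
  have hcomp := hsm.comp (contDiff_prodMk_left (0 : ℝ))
  convert hcomp using 2 with u
  have hfT : ∀ a, f ((u, 0) - T a) = f (u + (a.1 * Real.sin θ) • (a.2 : EuclideanSpace ℝ _),
      a.1 * Real.cos θ) := by
    intro a
    simp [hT]
  obtain ⟨C, hC⟩ := hfc.exists_bound_of_continuous hf.continuous
  have hint : Integrable (fun a => w (T a) * f ((u, 0) - T a)) ρ := by
    simp only [hwT]
    exact hvρ.mul_bdd (hf.continuous.comp (by fun_prop)).aestronglyMeasurable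
      (Filter.Eventually.of_forall fun a => hC _)
  simp only [Function.comp_apply]
  rw [integral_prod _ hint, coneRadon,
    setIntegral_eq_of_subset_of_forall_sdiff_eq_zero measurableSet_Ioi hS0]
  · simp only [hwT, hfT, hv, integral_const_mul, integral_mul_const]
    congr 1 with s
    ring
  · intro s hs
    simp [hfS s hs.2]

/-- for each `θ ∈ (0, π/2)`, the function `k ↦ |k|^{d-1} (F R^(p) f)(k, θ)` is
absolutely integrable on `ℝ^{d-1}`, and in particular so is `k ↦ (F R^(p) f)(k, θ)`. -/
theorem coneRadon_fourier_integrable (d : ℕ) (hd : 2 ≤ d) (p : ℝ)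
    (f : EuclideanSpace ℝ (Fin (d - 1)) × ℝ → ℝ)
    (hf : ContDiff ℝ (⊤ : ℕ∞) f) (hfc : HasCompactSupport f)
    (hfs : tsupport f ⊆ {q : EuclideanSpace ℝ (Fin (d - 1)) × ℝ | 0 < q.2})
    (θ : ℝ) (hθ : θ ∈ Set.Ioo (0 : ℝ) (π / 2)) :
    Integrable (fun k : EuclideanSpace ℝ (Fin (d - 1)) =>
        ((‖k‖ ^ (d - 1) : ℝ) : ℂ) * fourierFirst d (coneRadon d p f) k θ) ∧
      Integrable (fun k : EuclideanSpace ℝ (Fin (d - 1)) =>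
        fourierFirst d (coneRadon d p f) k θ) := by
  have hc : 0 < Real.cos θ := Real.cos_pos_of_mem_Ioo ⟨by linarith [hθ.1, hθ.2], hθ.2⟩
  have h := integrable_norm_pow_mul_fourierFirst
    (hasCompactSupport_coneRadon d p hfc hc.ne') (contDiff_coneRadon d p hf hfc hfs hc)
  exact ⟨h _, by simpa using h 0⟩
end
end
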